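/- arXiv:math/0004104 — 5 statements merged into one kernel-verified Lean document; each statement's English description precedes it below -/
import Mathlib

section
/- Let (Ω, 𝓔) be a standard Borel space and let σ be a Borel probability measure on the countable product Ω^ℕ. Let σ₁ be the probability measure on Ω given by σ₁(A) = σ(A × Ω × Ω × ⋯) for A ∈ 𝓔, and let σ₂ be the probability measure on Ω × Ω determined by σ₂(A₁ × A₂) = σ(A₁ × A₂ × Ω × Ω × ⋯) for A₁, A₂ ∈ 𝓔. Suppose that (i) σ is invariant under all finite permutations of the coordinates of Ω^ℕ (permutations leaving all but finitely many coordinates fixed), and (ii) σ₂ = σ₁ × σ₁. Then σ equals the infinite product measure ⨂_{n=1}^∞ σ₁. -/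
open MeasureTheory

/-- A bounded function that has the same inner product `c` with every member of a bounded
orthogonal sequence is orthogonal to that sequence. -/
lemma eq_zero_of_forall_integral_mul_eq {X : Type*} [MeasurableSpace X]
    (μ : Measure X) [IsProbabilityMeasure μ] (G : X → ℝ) (F : ℕ → X → ℝ) (c : ℝ)
    (hG : MemLp G 2 μ) (hF : ∀ k, MemLp (F k) 2 μ) (hF1 : ∀ k, ∫ x, F k x ^ 2 ∂μ ≤ 1)
    (horth : ∀ j k, j ≠ k → ∫ x, F j x * F k x ∂μ = 0)
    (hc : ∀ k, ∫ x, G x * F k x ∂μ = c) : c = 0 := by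
  have hH (N : ℕ) : MemLp (fun x => G x - c * ∑ k ∈ Finset.range N, F k x) 2 μ :=
    hG.sub ((memLp_finsetSum _ fun k _ => hF k).const_mul c)
  have hHF (N : ℕ) : ∫ x, (G x - c * ∑ k ∈ Finset.range N, F k x) * F N x ∂μ = c := by
    have hexp : (fun x => (G x - c * ∑ k ∈ Finset.range N, F k x) * F N x) =
        fun x => G x * F N x - c * ∑ k ∈ Finset.range N, F k x * F N x := by
      ext x
      rw [← Finset.sum_mul]
      ring
    have hint (k : ℕ) : Integrable (fun x => F k x * F N x) μ := (hF k).integrable_mul (hF N)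
    have hGF : Integrable (fun x => G x * F N x) μ := hG.integrable_mul (hF N)
    rw [hexp, integral_sub hGF
      ((integrable_finsetSum _ fun k _ => hint k).const_mul c), hc, integral_const_mul,
      integral_finsetSum _ fun k _ => hint k, Finset.sum_eq_zero, mul_zero, sub_zero]
    intro k hk
    exact horth k N (Finset.mem_range.1 hk).ne
  have hbound (N : ℕ) : ∫ x, (G x - c * ∑ k ∈ Finset.range N, F k x) ^ 2 ∂μ ≤
      ∫ x, G x ^ 2 ∂μ - N * c ^ 2 := by
    induction N with
    | zero => simp
    | succ N ih =>
      have hexp : (fun x => (G x - c * ∑ k ∈ Finset.range (N + 1), F k x) ^ 2) =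
          fun x => (G x - c * ∑ k ∈ Finset.range N, F k x) ^ 2 -
            2 * c * ((G x - c * ∑ k ∈ Finset.range N, F k x) * F N x) + c ^ 2 * F N x ^ 2 := by
        ext x
        rw [Finset.sum_range_succ]
        ring
      have hcross : Integrable (fun x => 2 * c *
          ((G x - c * ∑ k ∈ Finset.range N, F k x) * F N x)) μ :=
        ((hH N).integrable_mul (hF N)).const_mul (2 * c)
      have hdiff : Integrable (fun x => (G x - c * ∑ k ∈ Finset.range N, F k x) ^ 2 -
          2 * c * ((G x - c * ∑ k ∈ Finset.range N, F k x) * F N x)) μ :=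
        (hH N).integrable_sq.sub hcross
      rw [hexp, integral_add hdiff ((hF N).integrable_sq.const_mul _),
        integral_sub (hH N).integrable_sq hcross, integral_const_mul, integral_const_mul, hHF]
      push_cast
      nlinarith [mul_le_mul_of_nonneg_left (hF1 N) (sq_nonneg c)]
  by_contra hne
  obtain ⟨N, hN⟩ := exists_nat_gt ((∫ x, G x ^ 2 ∂μ) / c ^ 2)
  have hpos : 0 < c ^ 2 := by positivity
  rw [div_lt_iff₀ hpos] at hN
  have hnonneg : 0 ≤ ∫ x, (G x - c * ∑ k ∈ Finset.range N, F k x) ^ 2 ∂μ :=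
    integral_nonneg fun x => sq_nonneg _
  linarith [hbound N]

lemma finite_setOf_swap_ne {α : Type*} [DecidableEq α] (a b : α) :
    {n | Equiv.swap a b n ≠ n}.Finite := by
  refine (Set.toFinite {a, b}).subset fun n hn => ?_
  by_contra h
  simp only [Set.mem_insert_iff, Set.mem_singleton_iff, not_or] at h
  exact hn (Equiv.swap_apply_of_ne_of_ne h.1 h.2)

/-- Any two distinct natural numbers are the images of `0` and `1` under a finite permutation. -/
lemma exists_finite_perm_apply_zero_one {j k : ℕ} (hjk : j ≠ k) :
    ∃ π : Equiv.Perm ℕ, {n | π n ≠ n}.Finite ∧ π 0 = j ∧ π 1 = k := by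
  have hne : j ≠ Equiv.swap 0 j 1 := by
    intro h
    have := (Equiv.swap 0 j).injective ((Equiv.swap_apply_left 0 j).trans h)
    omega
  refine ⟨(Equiv.swap 0 j).trans (Equiv.swap (Equiv.swap 0 j 1) k), ?_, ?_, ?_⟩
  · refine ((finite_setOf_swap_ne 0 j).union
      (finite_setOf_swap_ne (Equiv.swap 0 j 1) k)).subset fun n hn => ?_
    by_contra h
    simp only [Set.mem_union, Set.mem_ofPred_eq, not_or, not_not] at h
    apply hn
    rw [Equiv.trans_apply, h.1, h.2]
  · rw [Equiv.trans_apply, Equiv.swap_apply_left, Equiv.swap_apply_of_ne_of_ne hne hjk]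
  · rw [Equiv.trans_apply, Equiv.swap_apply_left]

lemma measurableSet_setOf_forall_mem_finset {ι Ω : Type*} [MeasurableSpace Ω] (I : Finset ι)
    {s : ι → Set Ω} (hs : ∀ i, MeasurableSet (s i)) :
    MeasurableSet {x : ι → Ω | ∀ i ∈ I, x i ∈ s i} :=
  MeasurableSet.pi I.countable_toSet fun i _ => hs i

section Exchangeable

variable {Ω : Type*} [MeasurableSpace Ω] {σ : Measure (ℕ → Ω)}

lemma map_pair_eq_of_perm_invariant
    (hperm : ∀ π : Equiv.Perm ℕ, {n : ℕ | π n ≠ n}.Finite →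
      Measure.map (fun x n => x (π n)) σ = σ) {j k : ℕ} (hjk : j ≠ k) :
    Measure.map (fun x : ℕ → Ω => (x j, x k)) σ =
      Measure.map (fun x : ℕ → Ω => (x 0, x 1)) σ := by
  obtain ⟨π, hπ, rfl, rfl⟩ := exists_finite_perm_apply_zero_one hjk
  conv_rhs => rw [← hperm π hπ]
  rw [Measure.map_map (by fun_prop) (by fun_prop)]
  rfl

lemma integral_comp_swap_of_perm_invariant
    (hperm : ∀ π : Equiv.Perm ℕ, {n : ℕ | π n ≠ n}.Finite →
      Measure.map (fun x n => x (π n)) σ = σ) (a b : ℕ) {φ : (ℕ → Ω) → ℝ} (hφ : Measurable φ) :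
    ∫ x, φ (fun n => x (Equiv.swap a b n)) ∂σ = ∫ x, φ x ∂σ := by
  conv_rhs => rw [← hperm _ (finite_setOf_swap_ne a b)]
  rw [integral_map (Measurable.aemeasurable (by fun_prop)) hφ.aestronglyMeasurable]

lemma integral_mul_eq_zero_of_perm_invariant [IsProbabilityMeasure σ]
    (hperm : ∀ π : Equiv.Perm ℕ, {n : ℕ | π n ≠ n}.Finite →
      Measure.map (fun x n => x (π n)) σ = σ)
    (hprod : Measure.map (fun x : ℕ → Ω => (x 0, x 1)) σ =
      (Measure.map (fun x : ℕ → Ω => x 0) σ).prod (Measure.map (fun x : ℕ → Ω => x 0) σ))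
    {f : Ω → ℝ} (hf : Measurable f)
    (hf0 : ∫ ω, f ω ∂(Measure.map (fun x : ℕ → Ω => x 0) σ) = 0) {j k : ℕ} (hjk : j ≠ k) :
    ∫ x, f (x j) * f (x k) ∂σ = 0 := by
  have hm : Measurable fun p : Ω × Ω => f p.1 * f p.2 := by fun_prop
  have hmap := integral_map (μ := σ) (φ := fun x : ℕ → Ω => (x j, x k))
    (Measurable.aemeasurable (by fun_prop)) hm.aestronglyMeasurable
  have : IsProbabilityMeasure (Measure.map (fun x : ℕ → Ω => x 0) σ) :=
    Measure.isProbabilityMeasure_map (Measurable.aemeasurable (by fun_prop))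
  rw [← hmap, map_pair_eq_of_perm_invariant hperm hjk, hprod, integral_prod_mul, hf0, mul_zero]

/-- Under exchangeability and pairwise independence, a centered function of one coordinate is
orthogonal to every cylinder set over the other coordinates. -/
lemma integral_indicator_mul_eq_zero_of_perm_invariant [IsProbabilityMeasure σ]
    (hperm : ∀ π : Equiv.Perm ℕ, {n : ℕ | π n ≠ n}.Finite →
      Measure.map (fun x n => x (π n)) σ = σ)
    (hprod : Measure.map (fun x : ℕ → Ω => (x 0, x 1)) σ =
      (Measure.map (fun x : ℕ → Ω => x 0) σ).prod (Measure.map (fun x : ℕ → Ω => x 0) σ))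
    {f : Ω → ℝ} (hf : Measurable f) (hf1 : ∀ ω, |f ω| ≤ 1)
    (hf0 : ∫ ω, f ω ∂(Measure.map (fun x : ℕ → Ω => x 0) σ) = 0)
    {I : Finset ℕ} {j : ℕ} (hj : j ∉ I) {s : ℕ → Set Ω} (hs : ∀ i, MeasurableSet (s i)) :
    ∫ x, {x : ℕ → Ω | ∀ i ∈ I, x i ∈ s i}.indicator 1 x * f (x j) ∂σ = 0 := by
  have hA := measurableSet_setOf_forall_mem_finset I hs
  obtain ⟨M, hM⟩ := I.exists_nat_subset_range
  have hfM (k : ℕ) : Measurable fun x : ℕ → Ω => f (x (M + k)) := by fun_prop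
  have hind : Measurable ({x : ℕ → Ω | ∀ i ∈ I, x i ∈ s i}.indicator (1 : (ℕ → Ω) → ℝ)) :=
    measurable_one.indicator hA
  refine eq_zero_of_forall_integral_mul_eq σ
    ({x : ℕ → Ω | ∀ i ∈ I, x i ∈ s i}.indicator 1) (fun k x => f (x (M + k))) _ ?_ ?_ ?_ ?_ ?_
  · exact (memLp_const (1 : ℝ)).indicator hA
  · exact fun k => MemLp.of_bound (hfM k).aestronglyMeasurable 1 (.of_forall fun x => hf1 _)
  · intro k
    have hle : ∫ x : ℕ → Ω, f (x (M + k)) ^ 2 ∂σ ≤ ∫ _, (1 : ℝ) ∂σ :=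
      integral_mono_of_nonneg (.of_forall fun x => sq_nonneg _) (integrable_const _)
        (.of_forall fun x => (sq_le_one_iff_abs_le_one _).2 (hf1 _))
    simpa using hle
  · intro k l hkl
    exact integral_mul_eq_zero_of_perm_invariant hperm hprod hf hf0 (by omega)
  · intro k
    have hswap := integral_comp_swap_of_perm_invariant hperm j (M + k)
      (φ := fun x => {x : ℕ → Ω | ∀ i ∈ I, x i ∈ s i}.indicator 1 x * f (x j))
      (hind.mul (by fun_prop))
    rw [← hswap]
    have hmem (x : ℕ → Ω) : (fun n => x (Equiv.swap j (M + k) n)) ∈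
        {x : ℕ → Ω | ∀ i ∈ I, x i ∈ s i} ↔ x ∈ {x : ℕ → Ω | ∀ i ∈ I, x i ∈ s i} := by
      simp only [Set.mem_ofPred_eq]
      refine forall₂_congr fun i hi => ?_
      have hiM := Finset.mem_range.1 (hM hi)
      rw [Equiv.swap_apply_of_ne_of_ne (ne_of_mem_of_not_mem hi hj) (by omega)]
    congr 1 with x
    beta_reduce
    rw [Equiv.swap_apply_left]
    congr 1
    by_cases hx : x ∈ {x : ℕ → Ω | ∀ i ∈ I, x i ∈ s i}
    · rw [Set.indicator_of_mem hx, Set.indicator_of_mem ((hmem x).2 hx), Pi.one_apply,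
        Pi.one_apply]
    · rw [Set.indicator_of_notMem hx, Set.indicator_of_notMem (mt (hmem x).1 hx)]

end Exchangeable

/-- corollary of Hewitt–Savage: if a Borel probability measure `σ` on the
countable product `Ω^ℕ` of a standard Borel space is invariant under all finite permutations
of the coordinates, and its two-dimensional marginal is the product `σ₁ × σ₁` of its
one-dimensional marginals, then `σ` is the infinite product measure `⨂ σ₁`; here the infinite
product measure is characterized by its values on all finite-dimensional cylinder sets. -/
theorem stmt_7 {Ω : Type*} [MeasurableSpace Ω] [StandardBorelSpace Ω]
    (σ : Measure (ℕ → Ω)) [IsProbabilityMeasure σ]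
    (hperm : ∀ π : Equiv.Perm ℕ, {n : ℕ | π n ≠ n}.Finite →
      Measure.map (fun x n => x (π n)) σ = σ)
    (hprod : Measure.map (fun x : ℕ → Ω => (x 0, x 1)) σ =
      (Measure.map (fun x : ℕ → Ω => x 0) σ).prod (Measure.map (fun x : ℕ → Ω => x 0) σ)) :
    ∀ (I : Finset ℕ) (s : ℕ → Set Ω), (∀ i, MeasurableSet (s i)) →
      σ {x : ℕ → Ω | ∀ i ∈ I, x i ∈ s i} =
        ∏ i ∈ I, Measure.map (fun x : ℕ → Ω => x 0) σ (s i) := by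
  intro I s hs
  have : IsProbabilityMeasure (Measure.map (fun x : ℕ → Ω => x 0) σ) :=
    Measure.isProbabilityMeasure_map (Measurable.aemeasurable (by fun_prop))
  set σ₁ := Measure.map (fun x : ℕ → Ω => x 0) σ
  induction I using Finset.induction_on with
  | empty => simp
  | insert j I hj ih =>
    rw [Finset.prod_insert hj, ← ih]
    set A := {x : ℕ → Ω | ∀ i ∈ I, x i ∈ s i} with hA
    have hAm : MeasurableSet A := measurableSet_setOf_forall_mem_finset I hs
    have hBm : MeasurableSet ((fun x : ℕ → Ω => x j) ⁻¹' s j) := measurable_pi_apply j (hs j)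
    have hins : {x : ℕ → Ω | ∀ i ∈ insert j I, x i ∈ s i} =
        A ∩ (fun x : ℕ → Ω => x j) ⁻¹' s j := by
      ext x
      simp [hA, and_comm]
    have hint : Integrable ((s j).indicator (1 : Ω → ℝ)) σ₁ :=
      (integrable_const (1 : ℝ)).indicator (hs j)
    have hzero := integral_indicator_mul_eq_zero_of_perm_invariant hperm hprod
      (f := fun ω => (s j).indicator 1 ω - σ₁.real (s j))
      ((measurable_one.indicator (hs j)).sub_const _) (fun ω => by
        have h0 : 0 ≤ σ₁.real (s j) := measureReal_nonneg
        have h1 : σ₁.real (s j) ≤ 1 := measureReal_le_one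
        rw [abs_le]
        by_cases hω : ω ∈ s j
        · rw [Set.indicator_of_mem hω, Pi.one_apply]
          constructor <;> linarith
        · rw [Set.indicator_of_notMem hω]
          constructor <;> linarith)
      (by rw [integral_sub hint (integrable_const _), integral_indicator_one (hs j)]; simp)
      hj hs
    have hexp : (fun x : ℕ → Ω => A.indicator (1 : (ℕ → Ω) → ℝ) x *
        ((s j).indicator 1 (x j) - σ₁.real (s j))) =
        fun x => (A ∩ (fun x : ℕ → Ω => x j) ⁻¹' s j).indicator (1 : (ℕ → Ω) → ℝ) x -
          σ₁.real (s j) * A.indicator (1 : (ℕ → Ω) → ℝ) x := by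
      ext x
      by_cases hxA : x ∈ A <;> by_cases hxj : x j ∈ s j <;> simp [hxA, hxj]
    have hreal : σ.real (A ∩ (fun x : ℕ → Ω => x j) ⁻¹' s j) = σ₁.real (s j) * σ.real A := by
      have hind {B : Set (ℕ → Ω)} (hB : MeasurableSet B) :
          Integrable (B.indicator (1 : (ℕ → Ω) → ℝ)) σ :=
        (integrable_const (1 : ℝ)).indicator hB
      rw [hexp, integral_sub (hind (hAm.inter hBm)) ((hind hAm).const_mul _), integral_const_mul,
        integral_indicator_one hAm, integral_indicator_one (hAm.inter hBm)] at hzero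
      linarith
    rw [hins, ← ENNReal.toReal_eq_toReal_iff' (measure_ne_top _ _)
      (ENNReal.mul_ne_top (measure_ne_top _ _) (measure_ne_top _ _)), ENNReal.toReal_mul]
    exact hreal
end

section
/- Let p ∈ ℕ, let (μ_n)_{n≥1} be a sequence of Borel probability measures on [0,∞)^p converging in the weak* topology (i.e. against all continuous functions vanishing at infinity) to a Borel probability measure ν on [0,∞)^p with compact support. Suppose f and g are continuous real-valued functions on [0,∞)^p with g ≥ 0 and −g ≤ f ≤ g, and suppose lim_{n→∞} ∫ g dμ_n = ∫ g dν. Then lim_{n→∞} ∫ f dμ_n = ∫ f dν. -/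
open MeasureTheory Filter

/-- Weak* convergence tests against continuous compactly supported functions. -/
theorem tendsto_integral_of_hasCompactSupport {X : Type*} [TopologicalSpace X] [R1Space X]
    [MeasurableSpace X] {μ : ℕ → Measure X} {ν : Measure X}
    (hconv : ∀ f : ZeroAtInftyContinuousMap X ℝ,
      Tendsto (fun n => ∫ x, f x ∂(μ n)) atTop (nhds (∫ x, f x ∂ν)))
    {h : X → ℝ} (hc : Continuous h) (hs : HasCompactSupport h) :
    Tendsto (fun n => ∫ x, h x ∂(μ n)) atTop (nhds (∫ x, h x ∂ν)) :=
  hconv ⟨⟨h, hc⟩, hs.is_zero_at_infty⟩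

/-- If `|f| ≤ g` almost everywhere, truncating by a cutoff `χ` changes the integral of `f`
by at most as much as that of `g`. -/
theorem abs_integral_sub_integral_mul_le {X : Type*} [MeasurableSpace X] {m : Measure X}
    {f g χ : X → ℝ} (hf : Integrable f m) (hg : Integrable g m)
    (hfχ : Integrable (fun x => f x * χ x) m) (hgχ : Integrable (fun x => g x * χ x) m)
    (hfg : ∀ᵐ x ∂m, |f x| ≤ g x) (hχ : ∀ x, χ x ≤ 1) :
    |∫ x, f x ∂m - ∫ x, f x * χ x ∂m| ≤ ∫ x, g x ∂m - ∫ x, g x * χ x ∂m := by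
  rw [← integral_sub hf hfχ, ← integral_sub hg hgχ, ← Real.norm_eq_abs]
  refine norm_integral_le_of_norm_le (hg.sub hgχ) ?_
  filter_upwards [hfg] with x hx
  have h1 : 0 ≤ 1 - χ x := sub_nonneg.2 (hχ x)
  calc ‖f x - f x * χ x‖ = |f x| * (1 - χ x) := by
        rw [← mul_one_sub, Real.norm_eq_abs, abs_mul, abs_of_nonneg h1]
    _ ≤ g x * (1 - χ x) := by gcongr
    _ = g x - g x * χ x := by ring

/-- if probability measures `μ n` on `[0,∞)^p` converge in the weak* topology
to a compactly supported probability measure `ν`, and `f, g` are continuous functions on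
`[0,∞)^p` with `g ≥ 0`, `-g ≤ f ≤ g` there, and `∫ g dμ n → ∫ g dν`, then
`∫ f dμ n → ∫ f dν`.  (The convergence of the integrals of the nonnegative function `g`
is expressed via lower integrals.) -/
theorem stmt_10 (p : ℕ) (μ : ℕ → Measure (Fin p → ℝ)) (ν : Measure (Fin p → ℝ))
    [∀ n, IsProbabilityMeasure (μ n)] [IsProbabilityMeasure ν]
    (hμsupp : ∀ n, μ n {x : Fin p → ℝ | ¬ ∀ i, 0 ≤ x i} = 0)
    (hνsupp : ν {x : Fin p → ℝ | ¬ ∀ i, 0 ≤ x i} = 0)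
    (hconv : ∀ f : ZeroAtInftyContinuousMap (Fin p → ℝ) ℝ,
      Tendsto (fun n => ∫ x, f x ∂(μ n)) atTop (nhds (∫ x, f x ∂ν)))
    (hcpt : ∃ K : Set (Fin p → ℝ), IsCompact K ∧ ν Kᶜ = 0)
    (f g : (Fin p → ℝ) → ℝ) (hfc : Continuous f) (hgc : Continuous g)
    (hg0 : ∀ x : Fin p → ℝ, (∀ i, 0 ≤ x i) → 0 ≤ g x)
    (hlow : ∀ x : Fin p → ℝ, (∀ i, 0 ≤ x i) → -g x ≤ f x)
    (hupp : ∀ x : Fin p → ℝ, (∀ i, 0 ≤ x i) → f x ≤ g x)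
    (hgconv : Tendsto (fun n => ∫⁻ x, ENNReal.ofReal (g x) ∂(μ n)) atTop
      (nhds (∫⁻ x, ENNReal.ofReal (g x) ∂ν))) :
    Tendsto (fun n => ∫ x, f x ∂(μ n)) atTop (nhds (∫ x, f x ∂ν)) := by
  obtain ⟨K, hK, hνK⟩ := hcpt
  obtain ⟨χ, hχK, -, hχs, hχ⟩ :=
    exists_continuous_one_zero_of_isCompact hK isClosed_empty (Set.disjoint_empty K)
  have hμnonneg : ∀ n, ∀ᵐ x ∂(μ n), ∀ i, 0 ≤ x i := fun n => ae_iff.2 (hμsupp n)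
  have hνnonneg : ∀ᵐ x ∂ν, ∀ i, 0 ≤ x i := ae_iff.2 hνsupp
  have hcut : ∀ h : (Fin p → ℝ) → ℝ, (fun x => h x * χ x) =ᵐ[ν] h := by
    intro h
    filter_upwards [mem_ae_iff.2 hνK] with x hx
    simp [hχK hx]
  have hcont : ∀ {h : (Fin p → ℝ) → ℝ}, Continuous h → Continuous fun x => h x * χ x :=
    fun hh => hh.mul χ.continuous
  have hsupp : ∀ h : (Fin p → ℝ) → ℝ, HasCompactSupport fun x => h x * χ x :=
    fun h => hχs.mul_left
  have hlim : ∀ {h : (Fin p → ℝ) → ℝ}, Continuous h →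
      Tendsto (fun n => ∫ x, h x * χ x ∂(μ n)) atTop (nhds (∫ x, h x ∂ν)) := by
    intro h hh
    rw [← integral_congr_ae (hcut h)]
    exact tendsto_integral_of_hasCompactSupport hconv (hcont hh) (hsupp h)
  have hgν : Integrable g ν :=
    ((hcont hgc).integrable_of_hasCompactSupport (hsupp g)).congr (hcut g)
  have hgν_lt : ∫⁻ x, ENNReal.ofReal (g x) ∂ν < ⊤ := hgν.lintegral_lt_top
  have hgμ : ∀ᶠ n in atTop, Integrable g (μ n) := by
    filter_upwards [hgconv.eventually_lt_const hgν_lt] with n hn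
    refine (lintegral_ofReal_ne_top_iff_integrable hgc.aestronglyMeasurable ?_).1 hn.ne
    filter_upwards [hμnonneg n] with x hx using hg0 x hx
  have hgint : Tendsto (fun n => ∫ x, g x ∂(μ n)) atTop (nhds (∫ x, g x ∂ν)) := by
    have heq : ∀ {m : Measure (Fin p → ℝ)}, (∀ᵐ x ∂m, ∀ i, 0 ≤ x i) →
        ∫ x, g x ∂m = (∫⁻ x, ENNReal.ofReal (g x) ∂m).toReal := fun hm =>
      integral_eq_lintegral_of_nonneg_ae (hm.mono hg0) hgc.aestronglyMeasurable
    simp only [heq hνnonneg, heq (hμnonneg _)]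
    exact (ENNReal.tendsto_toReal hgν_lt.ne).comp hgconv
  have hdiff : Tendsto (fun n => ∫ x, f x ∂(μ n) - ∫ x, f x * χ x ∂(μ n)) atTop (nhds 0) := by
    refine squeeze_zero_norm' (a := fun n => ∫ x, g x ∂(μ n) - ∫ x, g x * χ x ∂(μ n)) ?_
      (by simpa using hgint.sub (hlim hgc))
    filter_upwards [hgμ] with n hn
    have hfg : ∀ᵐ x ∂(μ n), |f x| ≤ g x :=
      (hμnonneg n).mono fun x hx => abs_le.2 ⟨hlow x hx, hupp x hx⟩
    exact abs_integral_sub_integral_mul_le (hn.mono' hfc.aestronglyMeasurable hfg) hn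
      ((hcont hfc).integrable_of_hasCompactSupport (hsupp f))
      ((hcont hgc).integrable_of_hasCompactSupport (hsupp g)) hfg fun x => (hχ x).2
  simpa using hdiff.add (hlim hfc)
end

section
/- Let c ≥ 1. For each n ∈ ℕ let μ_n be the probability measure on ℂⁿ whose density with respect to Lebesgue measure (the product over coordinates of d(Re z)d(Im z)) is proportional to exp(−n Σ_{i=1}^n |z_i|²) · (∏_{i=1}^n |z_i|)^{2(c−1)n} · ∏_{1≤i<j≤n} |z_i − z_j|². For p ∈ {1,…,n} let μ_n^{(p)} be the marginal distribution of μ_n on the first p coordinates. Let ρ be the uniform probability distribution on the annulus {z ∈ ℂ : √(c−1) < |z| < √c}. Then for every fixed p ∈ ℕ, μ_n^{(p)} converges as n → ∞ to the product measure ρ^{⊗p} both in the weak* topology and in *-moments, i.e. for all nonnegative integers k₁,ℓ₁,…,k_p,ℓ_p, lim_{n→∞} ∫ z₁^{k₁} conj(z₁)^{ℓ₁} ⋯ z_p^{k_p} conj(z_p)^{ℓ_p} dμ_n^{(p)} = ∫ z₁^{k₁} conj(z₁)^{ℓ₁} ⋯ z_p^{k_p} conj(z_p)^{ℓ_p} d(ρ^{⊗p}).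 -/
open MeasureTheory Filter

/-- The uniform probability distribution on the annulus `{z : √(c-1) < |z| < √c}` in `ℂ`. -/
noncomputable def annulusUniform (c : ℝ) : Measure ℂ :=
  (volume {z : ℂ | Real.sqrt (c - 1) < ‖z‖ ∧ ‖z‖ < Real.sqrt c})⁻¹ •
    volume.restrict {z : ℂ | Real.sqrt (c - 1) < ‖z‖ ∧ ‖z‖ < Real.sqrt c}

/-- The mixed moments of a rotation invariant weight on `ℂ` vanish off the diagonal. -/
lemma integral_pow_mul_conj_pow_mul_radial_eq_zero (φ : ℝ → ℝ) {k l : ℕ} (hkl : k ≠ l) :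
    ∫ z : ℂ, z ^ k * (starRingEnd ℂ) z ^ l * (φ ‖z‖ : ℂ) = 0 := by
  have hN : k + l + 1 ≠ 0 := by omega
  have hζ := Complex.isPrimitiveRoot_exp (k + l + 1) hN
  set ζ : ℂ := Complex.exp (2 * ↑Real.pi * Complex.I / ↑(k + l + 1)) with hζdef
  have hnorm : ‖ζ‖ = 1 := hζ.norm'_eq_one hN
  let u : Circle := ⟨ζ, by simp [Submonoid.unitSphere, hnorm]⟩
  have hu : (u : ℂ) = ζ := rfl
  have hmp : MeasurePreserving (rotation u) volume volume :=
    LinearIsometryEquiv.measurePreserving (rotation u)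
  have hint := hmp.integral_comp (rotation u).toHomeomorph.measurableEmbedding
    (fun z : ℂ => z ^ k * (starRingEnd ℂ) z ^ l * (φ ‖z‖ : ℂ))
  set J := ∫ z : ℂ, z ^ k * (starRingEnd ℂ) z ^ l * (φ ‖z‖ : ℂ) with hJ
  have h2 : ∫ z : ℂ, (rotation u z) ^ k * (starRingEnd ℂ) (rotation u z) ^ l *
      (φ ‖rotation u z‖ : ℂ) = ζ ^ k * (starRingEnd ℂ) ζ ^ l * J := by
    rw [hJ, ← integral_const_mul]
    congr 1
    ext z
    simp only [rotation_apply, norm_mul, hu, hnorm, one_mul, map_mul, mul_pow]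
    ring
  rw [h2] at hint
  by_contra hne
  have h3 : ζ ^ k * (starRingEnd ℂ) ζ ^ l = 1 := mul_right_cancel₀ hne (by rw [hint, one_mul])
  have h4 : ζ * (starRingEnd ℂ) ζ = 1 := by
    rw [Complex.mul_conj, Complex.normSq_eq_norm_sq, hnorm]; simp
  have h5 : ζ ^ k = ζ ^ l := by
    calc ζ ^ k = ζ ^ k * (ζ * (starRingEnd ℂ) ζ) ^ l := by rw [h4, one_pow, mul_one]
      _ = (ζ ^ k * (starRingEnd ℂ) ζ ^ l) * ζ ^ l := by rw [mul_pow]; ring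
      _ = ζ ^ l := by rw [h3, one_mul]
  exact hkl (hζ.pow_inj (by omega) (by omega) h5)

/-- The weight `|z|^{2a} e^{-b|z|²}` of the induced Ginibre ensemble. -/
noncomputable def ginibreWeight (b a r : ℝ) : ℝ := r ^ (2 * a) * Real.exp (-b * r ^ 2)

/-- The squared norm of `z ^ k` with respect to the weight `ginibreWeight`. -/
noncomputable def ginibreNormSq (b a : ℝ) (k : ℕ) : ℝ :=
  ∫ z : ℂ, ‖z‖ ^ (2 * k) * ginibreWeight b a ‖z‖

lemma ginibreNormSq_eq {b a : ℝ} (hb : 0 < b) (ha : 0 ≤ a) (k : ℕ) :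
    ginibreNormSq b a k = Real.pi * b ^ (-(k + a + 1)) * Real.Gamma (k + a + 1) := by
  have h := Complex.integral_rpow_mul_exp_neg_mul_rpow (p := 2) (q := 2 * k + 2 * a) (b := b)
    (by norm_num) (lt_of_lt_of_le (by norm_num) (show (0 : ℝ) ≤ 2 * k + 2 * a by positivity)) hb
  have h1 : ginibreNormSq b a k =
      ∫ x : ℂ, ‖x‖ ^ (2 * k + 2 * a : ℝ) * Real.exp (-b * ‖x‖ ^ (2 : ℝ)) := by
    unfold ginibreNormSq ginibreWeight
    congr 1
    ext z
    rw [Real.rpow_add_of_nonneg (norm_nonneg z) (by positivity) (by positivity), ← mul_assoc]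
    congr 2
    · exact_mod_cast (Real.rpow_natCast ‖z‖ (2 * k)).symm
    · rw [Real.rpow_two]
  rw [h1, h]
  congr 2
  · ring
  · congr 1; ring
  · ring

lemma ginibreNormSq_pos {b a : ℝ} (hb : 0 < b) (ha : 0 ≤ a) (k : ℕ) : 0 < ginibreNormSq b a k := by
  rw [ginibreNormSq_eq hb ha]
  have : 0 < Real.Gamma (k + a + 1) := Real.Gamma_pos_of_pos (by positivity)
  positivity

lemma ginibreNormSq_succ {b a : ℝ} (hb : 0 < b) (ha : 0 ≤ a) (k : ℕ) :
    ginibreNormSq b a (k + 1) = (k + 1 + a) / b * ginibreNormSq b a k := by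
  rw [ginibreNormSq_eq hb ha, ginibreNormSq_eq hb ha]
  have h1 : ((k + 1 : ℕ) : ℝ) + a + 1 = (k + a + 1) + 1 := by push_cast; ring
  rw [h1, Real.Gamma_add_one (by positivity), neg_add, Real.rpow_add hb, Real.rpow_neg_one]
  field_simp
  ring

/-- The ratio of the squared norms of `z ^ (m + k)` and `z ^ m`. -/
noncomputable def ginibreRatio (b a : ℝ) (k m : ℕ) : ℝ :=
  ∏ r ∈ Finset.range k, (m + r + 1 + a) / b

lemma ginibreNormSq_add {b a : ℝ} (hb : 0 < b) (ha : 0 ≤ a) (m k : ℕ) :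
    ginibreNormSq b a (m + k) = ginibreNormSq b a m * ginibreRatio b a k m := by
  induction k with
  | zero => simp [ginibreRatio]
  | succ k ih =>
    rw [← add_assoc, ginibreNormSq_succ hb ha, ih, ginibreRatio, ginibreRatio,
      Finset.prod_range_succ]
    push_cast
    ring

lemma integrable_pow_mul_conj_pow_mul_ginibreWeight {b a : ℝ} (hb : 0 < b) (ha : 0 ≤ a)
    (k l : ℕ) :
    Integrable (fun z : ℂ => z ^ k * (starRingEnd ℂ) z ^ l * (ginibreWeight b a ‖z‖ : ℂ)) := by
  have hI : ∀ m : ℕ, Integrable (fun z : ℂ => ‖z‖ ^ (2 * m) * ginibreWeight b a ‖z‖) := fun m =>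
    Integrable.of_integral_ne_zero (ginibreNormSq_pos hb ha m).ne'
  have hw : ∀ z : ℂ, 0 ≤ ginibreWeight b a ‖z‖ := fun z => by
    unfold ginibreWeight; positivity
  refine ((hI 0).add (hI (k + l))).mono' ?_ (Eventually.of_forall fun z => ?_)
  · refine Measurable.aestronglyMeasurable ?_
    unfold ginibreWeight
    refine ((measurable_id.pow_const _).mul
      ((Complex.continuous_conj.measurable).pow_const _)).mul ?_
    exact Complex.measurable_ofReal.comp (by fun_prop)
  · simp only [norm_mul, norm_pow, RCLike.norm_conj, Pi.add_apply, mul_zero, pow_zero, one_mul]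
    rw [← pow_add, Complex.norm_real, Real.norm_of_nonneg (hw z)]
    have h : ‖z‖ ^ (k + l) ≤ 1 + ‖z‖ ^ (2 * (k + l)) := by
      rw [mul_comm 2, pow_mul]
      nlinarith [sq_nonneg (‖z‖ ^ (k + l) - 1), sq_nonneg (‖z‖ ^ (k + l))]
    nlinarith [mul_le_mul_of_nonneg_right h (hw z)]

lemma integral_pow_mul_conj_pow_mul_ginibreWeight (b a : ℝ) (k l : ℕ) :
    ∫ z : ℂ, z ^ k * (starRingEnd ℂ) z ^ l * (ginibreWeight b a ‖z‖ : ℂ) =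
      if k = l then (ginibreNormSq b a k : ℂ) else 0 := by
  split_ifs with h
  · subst h
    rw [ginibreNormSq, ← integral_complex_ofReal]
    congr 1
    ext z
    rw [← mul_pow, Complex.mul_conj, Complex.normSq_eq_norm_sq]
    push_cast
    rw [← pow_mul]
  · exact integral_pow_mul_conj_pow_mul_radial_eq_zero _ h

lemma integral_annulus_norm_pow {c : ℝ} (hc : 1 ≤ c) (k : ℕ) :
    ∫ z in {z : ℂ | Real.sqrt (c - 1) < ‖z‖ ∧ ‖z‖ < Real.sqrt c}, ‖z‖ ^ (2 * k) =
      Real.pi * ((c ^ (k + 1) - (c - 1) ^ (k + 1)) / (k + 1)) := by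
  have hS : MeasurableSet {z : ℂ | Real.sqrt (c - 1) < ‖z‖ ∧ ‖z‖ < Real.sqrt c} :=
    (measurableSet_lt measurable_const measurable_norm).inter
      (measurableSet_lt measurable_norm measurable_const)
  have hle : Real.sqrt (c - 1) ≤ Real.sqrt c := Real.sqrt_le_sqrt (by linarith)
  have h1 := integral_fun_norm_addHaar (volume : Measure ℂ)
    ((Set.Ioo (Real.sqrt (c - 1)) (Real.sqrt c)).indicator fun r : ℝ => r ^ (2 * k))
  have h2 : (volume : Measure ℂ).real (Metric.ball 0 1) = Real.pi := by
    simp [Measure.real, Complex.volume_ball]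
  have h3 : ∫ y in Set.Ioi (0 : ℝ), y ^ (Module.finrank ℝ ℂ - 1) •
      (Set.Ioo (Real.sqrt (c - 1)) (Real.sqrt c)).indicator (fun r : ℝ => r ^ (2 * k)) y =
      ∫ y in Real.sqrt (c - 1)..Real.sqrt c, y ^ (2 * k + 1) := by
    rw [intervalIntegral.integral_of_le hle, integral_Ioc_eq_integral_Ioo,
      ← integral_indicator measurableSet_Ioi, ← integral_indicator measurableSet_Ioo]
    congr 1
    ext y
    have := Real.sqrt_nonneg (c - 1)
    by_cases hy : y ∈ Set.Ioo (Real.sqrt (c - 1)) (Real.sqrt c)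
    · have h0 : y ∈ Set.Ioi (0 : ℝ) := lt_of_le_of_lt this hy.1
      simp only [Set.indicator_of_mem h0, Set.indicator_of_mem hy, Complex.finrank_real_complex,
        smul_eq_mul]
      ring
    · simp [Set.indicator_of_notMem hy]
  rw [h2, h3, integral_pow, Complex.finrank_real_complex] at h1
  have h4 : (fun z : ℂ => (Set.Ioo (Real.sqrt (c - 1)) (Real.sqrt c)).indicator
      (fun r : ℝ => r ^ (2 * k)) ‖z‖) =
      {z : ℂ | Real.sqrt (c - 1) < ‖z‖ ∧ ‖z‖ < Real.sqrt c}.indicator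
        fun z => ‖z‖ ^ (2 * k) := by
    ext z
    by_cases hz : Real.sqrt (c - 1) < ‖z‖ ∧ ‖z‖ < Real.sqrt c <;> simp [Set.indicator, hz]
  rw [h4, integral_indicator hS] at h1
  rw [h1]
  have h5 : ∀ x : ℝ, 0 ≤ x → Real.sqrt x ^ (2 * k + 1 + 1) = x ^ (k + 1) := fun x hx => by
    rw [show 2 * k + 1 + 1 = 2 * (k + 1) by ring, pow_mul, Real.sq_sqrt hx]
  rw [h5 c (by linarith), h5 (c - 1) (by linarith)]
  simp only [nsmul_eq_mul, smul_eq_mul]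
  push_cast
  field_simp
  ring

lemma volume_annulus {c : ℝ} (hc : 1 ≤ c) :
    volume {z : ℂ | Real.sqrt (c - 1) < ‖z‖ ∧ ‖z‖ < Real.sqrt c} = ENNReal.ofReal Real.pi := by
  have h := integral_annulus_norm_pow hc 0
  simp only [mul_zero, pow_zero, zero_add, pow_one, Nat.cast_zero, div_one, sub_sub_cancel,
    mul_one, integral_const, smul_eq_mul, measureReal_restrict_apply_univ] at h
  have hfin : volume {z : ℂ | Real.sqrt (c - 1) < ‖z‖ ∧ ‖z‖ < Real.sqrt c} ≠ ⊤ := by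
    refine ((measure_mono fun z hz => ?_).trans_lt
      (measure_ball_lt_top (μ := volume) (x := (0 : ℂ)) (r := Real.sqrt c))).ne
    simpa using hz.2
  rw [← h, ofReal_measureReal hfin]

lemma isProbabilityMeasure_annulusUniform {c : ℝ} (hc : 1 ≤ c) :
    IsProbabilityMeasure (annulusUniform c) := by
  constructor
  rw [annulusUniform, Measure.smul_apply, Measure.restrict_apply_univ, smul_eq_mul,
    volume_annulus hc]
  exact ENNReal.inv_mul_cancel (by simp [Real.pi_pos]) ENNReal.ofReal_ne_top

lemma ae_norm_le_annulusUniform (c : ℝ) : ∀ᵐ z ∂(annulusUniform c), ‖z‖ ≤ Real.sqrt c := by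
  have hS : MeasurableSet {z : ℂ | Real.sqrt (c - 1) < ‖z‖ ∧ ‖z‖ < Real.sqrt c} :=
    (measurableSet_lt measurable_const measurable_norm).inter
      (measurableSet_lt measurable_norm measurable_const)
  refine Measure.ae_smul_measure ?_ _
  filter_upwards [ae_restrict_mem hS] with z hz using hz.2.le

/-- The mixed moments of the uniform distribution on the annulus. -/
lemma integral_annulusUniform {c : ℝ} (hc : 1 ≤ c) (k l : ℕ) :
    ∫ z, z ^ k * (starRingEnd ℂ) z ^ l ∂(annulusUniform c) =
      if k = l then (((c ^ (k + 1) - (c - 1) ^ (k + 1)) / (k + 1) : ℝ) : ℂ) else 0 := by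
  have hS : MeasurableSet {z : ℂ | Real.sqrt (c - 1) < ‖z‖ ∧ ‖z‖ < Real.sqrt c} :=
    (measurableSet_lt measurable_const measurable_norm).inter
      (measurableSet_lt measurable_norm measurable_const)
  rw [annulusUniform, integral_smul_measure, volume_annulus hc]
  split_ifs with h
  · subst h
    have : ∀ z : ℂ, z ^ k * (starRingEnd ℂ) z ^ k = ((‖z‖ ^ (2 * k) : ℝ) : ℂ) := fun z => by
      rw [← mul_pow, Complex.mul_conj, Complex.normSq_eq_norm_sq]
      push_cast
      rw [← pow_mul]
    simp only [this]
    rw [integral_complex_ofReal, integral_annulus_norm_pow hc, ENNReal.toReal_inv,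
      ENNReal.toReal_ofReal Real.pi_pos.le, Complex.real_smul, ← Complex.ofReal_mul,
      inv_mul_cancel_left₀ Real.pi_pos.ne']
  · rw [← integral_indicator hS]
    have := integral_pow_mul_conj_pow_mul_radial_eq_zero
      ((Set.Ioo (Real.sqrt (c - 1)) (Real.sqrt c)).indicator fun _ => 1) h
    have h4 : (fun z : ℂ => z ^ k * (starRingEnd ℂ) z ^ l *
        (((Set.Ioo (Real.sqrt (c - 1)) (Real.sqrt c)).indicator (fun _ => (1 : ℝ)) ‖z‖ : ℝ) : ℂ)) =
        {z : ℂ | Real.sqrt (c - 1) < ‖z‖ ∧ ‖z‖ < Real.sqrt c}.indicator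
          fun z => z ^ k * (starRingEnd ℂ) z ^ l := by
      ext z
      by_cases hz : Real.sqrt (c - 1) < ‖z‖ ∧ ‖z‖ < Real.sqrt c <;> simp [Set.indicator, hz]
    rw [← h4, this, smul_zero]

open Equiv.Perm (sign)

lemma prod_norm_sub_sq_eq_sum_perm {n : ℕ} (z : Fin n → ℂ) :
    ((∏ i, ∏ j ∈ Finset.Ioi i, ‖z i - z j‖ ^ 2 : ℝ) : ℂ) =
      ∑ σ : Equiv.Perm (Fin n), ∑ τ : Equiv.Perm (Fin n), ((sign σ * sign τ : ℤˣ) : ℂ) *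
        ∏ i, (z i ^ (σ i : ℕ) * (starRingEnd ℂ) (z i) ^ (τ i : ℕ)) := by
  have hdet : (Matrix.vandermonde z).det =
      ∑ σ : Equiv.Perm (Fin n), ((sign σ : ℤˣ) : ℂ) * ∏ i, z i ^ (σ i : ℕ) := by
    rw [← Matrix.det_transpose, Matrix.det_apply']
    simp [Matrix.vandermonde]
  have h1 : ((∏ i, ∏ j ∈ Finset.Ioi i, ‖z i - z j‖ ^ 2 : ℝ) : ℂ) =
      (Matrix.vandermonde z).det * (starRingEnd ℂ) (Matrix.vandermonde z).det := by
    rw [Complex.mul_conj, Matrix.det_vandermonde]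
    simp only [map_prod, Complex.normSq_eq_norm_sq]
    congr 1
    refine Finset.prod_congr rfl fun i _ => Finset.prod_congr rfl fun j _ => ?_
    rw [norm_sub_rev]
  rw [h1, hdet, map_sum, Finset.sum_mul_sum]
  refine Finset.sum_congr rfl fun σ _ => Finset.sum_congr rfl fun τ _ => ?_
  rw [Finset.prod_mul_distrib]
  simp only [map_mul, map_prod, map_pow, map_intCast]
  push_cast
  ring

lemma prod_ginibreWeight {n : ℕ} (b a : ℝ) (z : Fin n → ℂ) :
    ∏ i, ginibreWeight b a ‖z i‖ =
      Real.exp (-b * ∑ i, ‖z i‖ ^ 2) * (∏ i, ‖z i‖) ^ (2 * a) := by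
  simp only [ginibreWeight]
  rw [Finset.prod_mul_distrib, ← Real.exp_sum, Finset.mul_sum,
    Real.finsetProd_rpow _ _ fun _ _ => norm_nonneg _]
  ring

/-- The density of the induced Ginibre ensemble with parameters `a`, `b` and normalization `K`. -/
noncomputable def ginibreDensity {n : ℕ} (K b a : ℝ) (z : Fin n → ℂ) : ℝ :=
  K * Real.exp (-b * ∑ i, ‖z i‖ ^ 2) * (∏ i, ‖z i‖) ^ (2 * a) *
    ∏ i, ∏ j ∈ Finset.Ioi i, ‖z i - z j‖ ^ 2

lemma ginibreDensity_nonneg {n : ℕ} {K : ℝ} (hK : 0 < K) (b a : ℝ) (z : Fin n → ℂ) :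
    0 ≤ ginibreDensity K b a z := by
  unfold ginibreDensity
  positivity

lemma measurable_ginibreDensity {n : ℕ} (K b a : ℝ) :
    Measurable (ginibreDensity K b a : (Fin n → ℂ) → ℝ) := by
  unfold ginibreDensity
  fun_prop

lemma ginibreDensity_smul_monomial {n : ℕ} (K b a : ℝ) (k l : Fin n → ℕ) (z : Fin n → ℂ) :
    ginibreDensity K b a z • (∏ i, z i ^ k i * (starRingEnd ℂ) (z i) ^ l i) =
      (K : ℂ) * ∑ σ : Equiv.Perm (Fin n), ∑ τ : Equiv.Perm (Fin n),
        ((sign σ * sign τ : ℤˣ) : ℂ) *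
        ∏ i, (z i ^ (σ i + k i) * (starRingEnd ℂ) (z i) ^ (τ i + l i) *
          (ginibreWeight b a ‖z i‖ : ℂ)) := by
  rw [ginibreDensity, mul_assoc K, ← prod_ginibreWeight, Complex.real_smul, Complex.ofReal_mul,
    Complex.ofReal_mul, prod_norm_sub_sq_eq_sum_perm, mul_assoc, mul_assoc]
  congr 1
  rw [← mul_assoc, Finset.mul_sum, Finset.sum_mul]
  refine Finset.sum_congr rfl fun σ _ => ?_
  rw [Finset.mul_sum, Finset.sum_mul]
  refine Finset.sum_congr rfl fun τ _ => ?_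
  simp only [Finset.prod_mul_distrib, pow_add, Complex.ofReal_prod]
  ring

section Ensemble

variable {n : ℕ} {K b a : ℝ} {μ : Measure (Fin n → ℂ)}

lemma integrable_ginibreDensity_smul_term (hb : 0 < b) (ha : 0 ≤ a) (k l : Fin n → ℕ) :
    Integrable (fun z : Fin n → ℂ => ∏ i, (z i ^ k i * (starRingEnd ℂ) (z i) ^ l i *
          (ginibreWeight b a ‖z i‖ : ℂ))) :=
  Integrable.fintype_prod (f := fun i (z : ℂ) => z ^ k i * (starRingEnd ℂ) z ^ l i *
    (ginibreWeight b a ‖z‖ : ℂ)) fun _ =>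
      integrable_pow_mul_conj_pow_mul_ginibreWeight hb ha _ _

lemma integrable_monomial (hb : 0 < b) (ha : 0 ≤ a) (hK : 0 < K)
    (hμ : μ = volume.withDensity fun z => ENNReal.ofReal (ginibreDensity K b a z))
    (k l : Fin n → ℕ) :
    Integrable (fun z : Fin n → ℂ => ∏ i, z i ^ k i * (starRingEnd ℂ) (z i) ^ l i) μ := by
  rw [hμ, integrable_withDensity_iff_integrable_smul'
    (measurable_ginibreDensity K b a).ennreal_ofReal (by simp)]
  simp only [ENNReal.toReal_ofReal (ginibreDensity_nonneg hK b a _), ginibreDensity_smul_monomial]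
  refine Integrable.const_mul (integrable_finsetSum _ fun σ _ => integrable_finsetSum _ fun τ _ =>
    Integrable.const_mul ?_ _) _
  exact integrable_ginibreDensity_smul_term hb ha _ _

lemma integral_monomial_eq_sum_perm (hb : 0 < b) (ha : 0 ≤ a) (hK : 0 < K)
    (hμ : μ = volume.withDensity fun z => ENNReal.ofReal (ginibreDensity K b a z))
    (k l : Fin n → ℕ) :
    ∫ z, ∏ i, z i ^ k i * (starRingEnd ℂ) (z i) ^ l i ∂μ =
      (K : ℂ) * ∑ σ : Equiv.Perm (Fin n), ∑ τ : Equiv.Perm (Fin n),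
        ((sign σ * sign τ : ℤˣ) : ℂ) *
        ∏ i, if (σ i + k i : ℕ) = τ i + l i then (ginibreNormSq b a (σ i + k i) : ℂ) else 0 := by
  rw [hμ, integral_withDensity_eq_integral_toReal_smul
    (measurable_ginibreDensity K b a).ennreal_ofReal (by simp)]
  simp only [ENNReal.toReal_ofReal (ginibreDensity_nonneg hK b a _), ginibreDensity_smul_monomial]
  rw [integral_const_mul, integral_finsetSum _ fun σ _ => integrable_finsetSum _ fun τ _ =>
    Integrable.const_mul (integrable_ginibreDensity_smul_term hb ha _ _) _]
  congr 1
  refine Finset.sum_congr rfl fun σ _ => ?_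
  rw [integral_finsetSum _ fun τ _ =>
    Integrable.const_mul (integrable_ginibreDensity_smul_term hb ha _ _) _]
  refine Finset.sum_congr rfl fun τ _ => ?_
  rw [integral_const_mul, integral_fintype_prod_volume_eq_prod (fun i (z : ℂ) =>
    z ^ (σ i + k i : ℕ) * (starRingEnd ℂ) z ^ (τ i + l i : ℕ) * (ginibreWeight b a ‖z‖ : ℂ))]
  simp only [integral_pow_mul_conj_pow_mul_ginibreWeight]

/-- The signed number of pairings of the permutation `σ` shifted by `k` with a permutation
shifted by `l`. -/
def signedShiftCount (k l : Fin n → ℕ) (σ : Equiv.Perm (Fin n)) : ℤ :=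
  ∑ τ : Equiv.Perm (Fin n),
    if ∀ i, (σ i + k i : ℕ) = τ i + l i then ((sign σ * sign τ : ℤˣ) : ℤ) else 0

lemma integral_monomial_eq_sum_signedShiftCount (hb : 0 < b) (ha : 0 ≤ a) (hK : 0 < K)
    (hμ : μ = volume.withDensity fun z => ENNReal.ofReal (ginibreDensity K b a z))
    (k l : Fin n → ℕ) :
    ∫ z, ∏ i, z i ^ k i * (starRingEnd ℂ) (z i) ^ l i ∂μ =
      ((K * (∏ i : Fin n, ginibreNormSq b a i) * ∑ σ : Equiv.Perm (Fin n),
        signedShiftCount k l σ * ∏ i, ginibreRatio b a (k i) (σ i) : ℝ) : ℂ) := by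
  rw [integral_monomial_eq_sum_perm hb ha hK hμ]
  push_cast
  rw [mul_assoc]
  congr 1
  rw [Finset.mul_sum]
  refine Finset.sum_congr rfl fun σ _ => ?_
  have h1 : (∏ i : Fin n, (ginibreNormSq b a i : ℂ)) = ∏ i, (ginibreNormSq b a (σ i) : ℂ) :=
    (Equiv.prod_comp σ fun i : Fin n => (ginibreNormSq b a i : ℂ)).symm
  rw [signedShiftCount, Int.cast_sum, Finset.sum_mul, Finset.mul_sum]
  refine Finset.sum_congr rfl fun τ _ => ?_
  split_ifs with h
  · rw [h1]
    simp only [if_pos (h _), ginibreNormSq_add hb ha]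
    push_cast
    rw [Finset.prod_mul_distrib]
    ring
  · push Not at h
    obtain ⟨i, hi⟩ := h
    rw [Finset.prod_eq_zero (Finset.mem_univ i) (if_neg hi)]
    simp

lemma signedShiftCount_zero (σ : Equiv.Perm (Fin n)) : signedShiftCount 0 0 σ = 1 := by
  rw [signedShiftCount, Finset.sum_eq_single σ]
  · simp
  · intro τ _ hτ
    rw [if_neg]
    intro h
    exact hτ (Equiv.ext fun i => Fin.ext (by simpa using (h i).symm))
  · simp

lemma normalization_eq [IsProbabilityMeasure μ] (hb : 0 < b) (ha : 0 ≤ a) (hK : 0 < K)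
    (hμ : μ = volume.withDensity fun z => ENNReal.ofReal (ginibreDensity K b a z)) :
    K * (∏ i : Fin n, ginibreNormSq b a i) = (n.factorial : ℝ)⁻¹ := by
  have h := integral_monomial_eq_sum_signedShiftCount hb ha hK hμ 0 0
  simp only [Pi.zero_apply, pow_zero, mul_one, Finset.prod_const_one, integral_const, probReal_univ,
    one_smul, signedShiftCount_zero, ginibreRatio, Finset.range_zero, Finset.prod_empty,
    Int.cast_one, Finset.sum_const, Finset.card_univ, Fintype.card_perm, Fintype.card_fin,
    nsmul_eq_mul] at h
  exact eq_inv_of_mul_eq_one_left (by exact_mod_cast h.symm)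

end Ensemble

section Combinatorics

variable {n p : ℕ}

lemma abs_signedShiftCount_le_one (k l : Fin n → ℕ) (σ : Equiv.Perm (Fin n)) :
    |signedShiftCount k l σ| ≤ 1 := by
  unfold signedShiftCount
  by_cases h : ∃ τ : Equiv.Perm (Fin n), ∀ i, (σ i + k i : ℕ) = τ i + l i
  · obtain ⟨τ, hτ⟩ := h
    rw [Finset.sum_eq_single τ]
    · rw [if_pos hτ]
      rcases Int.units_eq_one_or (sign σ * sign τ) with h | h <;> simp [h]
    · intro τ' _ hne
      rw [if_neg]
      intro h'
      exact hne (Equiv.ext fun i => Fin.ext (by have := h' i; have := hτ i; omega))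
    · simp
  · push Not at h
    rw [Finset.sum_eq_zero fun τ _ => if_neg (by simpa using h τ)]
    simp

/-- The values of `x` at distinct indices differ by more than `M`. -/
def IsSeparatedBy (M : ℕ) (x : Fin p → Fin n) : Prop :=
  ∀ i j, i ≠ j → (x i : ℕ) + M < x j ∨ (x j : ℕ) + M < x i

lemma IsSeparatedBy.injective {M : ℕ} {x : Fin p → Fin n} (h : IsSeparatedBy M x) :
    Function.Injective x := by
  intro i j hij
  by_contra hne
  rcases h i j hne with h | h <;> rw [hij] at h <;> omega

lemma signedShiftCount_of_isSeparatedBy (e : Fin p ↪ Fin n) {M : ℕ} {k l : Fin p → ℕ}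
    (hk : ∀ i, k i ≤ M) (hl : ∀ i, l i ≤ M) (σ : Equiv.Perm (Fin n))
    (hσ : IsSeparatedBy M fun i => σ (e i)) :
    signedShiftCount (Function.extend e k 0) (Function.extend e l 0) σ =
      if k = l then 1 else 0 := by
  have key : ∀ τ : Equiv.Perm (Fin n), (∀ i, (σ i + Function.extend e k 0 i : ℕ) =
      τ i + Function.extend e l 0 i) → τ = σ ∧ k = l := by
    intro τ hτ
    have hout : ∀ i, i ∉ Set.range e → σ i = τ i := fun i hi => by
      have := hτ i
      rw [Function.extend_apply' _ _ _ hi, Function.extend_apply' _ _ _ hi] at this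
      exact Fin.ext (by simpa using this)
    have hin : ∀ j, σ (e j) = τ (e j) ∧ k j = l j := by
      intro j
      have hj := hτ (e j)
      rw [e.injective.extend_apply, e.injective.extend_apply] at hj
      obtain ⟨m, hm⟩ := σ.surjective (τ (e j))
      by_cases hmr : m ∈ Set.range e
      · obtain ⟨j', rfl⟩ := hmr
        have hjj : j = j' := by
          by_contra hne
          have h1 := hk j
          have h2 := hl j
          rw [← hm] at hj
          have hsep := hσ j j' hne
          beta_reduce at hsep
          omega
        subst hjj
        rw [hm] at hj
        exact ⟨hm, by omega⟩
      · have := hout m hmr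
        rw [hm] at this
        exact absurd ⟨j, (τ.injective this)⟩ hmr
    refine ⟨Equiv.ext fun i => ?_, funext fun j => (hin j).2⟩
    by_cases hi : i ∈ Set.range e
    · obtain ⟨j, rfl⟩ := hi
      exact (hin j).1.symm
    · exact (hout i hi).symm
  unfold signedShiftCount
  split_ifs with h
  · subst h
    rw [Finset.sum_eq_single σ]
    · simp
    · intro τ _ hne
      rw [if_neg fun h' => hne (key τ h').1]
    · simp
  · exact Finset.sum_eq_zero fun τ _ => if_neg fun h' => h (key τ h').2

/-- Averaging over permutations is averaging over injections. -/
lemma sum_perm_comp_embedding (e : Fin p ↪ Fin n) (F : (Fin p → Fin n) → ℝ) :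
    (n.descFactorial p : ℝ) * ∑ σ : Equiv.Perm (Fin n), F (fun i => σ (e i)) =
      n.factorial * ∑ x : Fin p ↪ Fin n, F x := by
  have h1 : ∀ x : Fin p ↪ Fin n, ∑ σ : Equiv.Perm (Fin n), F (fun i => σ (x i)) =
      ∑ σ : Equiv.Perm (Fin n), F (fun i => σ (e i)) := by
    intro x
    obtain ⟨g, hg⟩ := (Equiv.Perm.isMultiplyPretransitive (Fin n) p).exists_smul_eq e x
    have hg' : ∀ i, x i = g (e i) := fun i => by rw [← hg]; rfl
    simp only [hg']
    exact Equiv.sum_comp (Equiv.mulRight g) fun σ : Equiv.Perm (Fin n) => F (fun i => σ (e i))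
  have h2 : ∀ σ : Equiv.Perm (Fin n), ∑ x : Fin p ↪ Fin n, F (fun i => σ (x i)) =
      ∑ x : Fin p ↪ Fin n, F x := fun σ =>
    Equiv.sum_comp (Equiv.embeddingCongr (Equiv.refl (Fin p)) σ) fun x : Fin p ↪ Fin n => F x
  have h3 := Finset.sum_comm (s := (Finset.univ : Finset (Fin p ↪ Fin n)))
    (t := (Finset.univ : Finset (Equiv.Perm (Fin n)))) (f := fun x σ => F (fun i => σ (x i)))
  simp only [h1, h2, Finset.sum_const, Finset.card_univ, Fintype.card_embedding_eq,
    Fintype.card_fin, Fintype.card_perm, nsmul_eq_mul] at h3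
  exact h3

lemma sum_embedding_le_sum {F : (Fin p → Fin n) → ℝ} (hF : ∀ x, 0 ≤ F x) :
    ∑ x : Fin p ↪ Fin n, F x ≤ ∑ x, F x := by
  refine (Finset.sum_map Finset.univ ⟨fun x : Fin p ↪ Fin n => (x : Fin p → Fin n),
    DFunLike.coe_injective⟩ F).symm.trans_le ?_
  exact Finset.sum_le_sum_of_subset_of_nonneg (Finset.subset_univ _) fun x _ _ => hF x

lemma sum_embedding_eq_sum {F : (Fin p → Fin n) → ℝ}
    (hF : ∀ x, ¬ Function.Injective x → F x = 0) :
    ∑ x : Fin p ↪ Fin n, F x = ∑ x, F x := by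
  refine (Finset.sum_map Finset.univ ⟨fun x : Fin p ↪ Fin n => (x : Fin p → Fin n),
    DFunLike.coe_injective⟩ F).symm.trans ?_
  refine Finset.sum_subset (Finset.subset_univ _) fun x _ hx => hF x fun hinj => hx ?_
  rw [Finset.mem_map]
  exact ⟨⟨x, hinj⟩, Finset.mem_univ _, rfl⟩

open Classical in
lemma card_not_isSeparatedBy_le (M : ℕ) :
    (Finset.univ.filter fun x : Fin p → Fin n => ¬ IsSeparatedBy M x).card ≤
      p * p * ((2 * M + 1) * n ^ (p - 1)) := by
  let B : Fin p × Fin p → Finset (Fin p → Fin n) := fun q => Finset.univ.filter fun x =>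
    q.1 ≠ q.2 ∧ (x q.1 : ℕ) ≤ x q.2 + M ∧ (x q.2 : ℕ) ≤ x q.1 + M
  have hsub : (Finset.univ.filter fun x : Fin p → Fin n => ¬ IsSeparatedBy M x) ⊆
      Finset.univ.biUnion B := by
    intro x hx
    replace hx := (Finset.mem_filter.mp hx).2
    unfold IsSeparatedBy at hx
    push Not at hx
    obtain ⟨i, j, hij, h1, h2⟩ := hx
    simp only [Finset.mem_biUnion, Finset.mem_univ, true_and, B, Finset.mem_filter]
    exact ⟨(i, j), hij, h2, h1⟩
  have hB : ∀ q, (B q).card ≤ (2 * M + 1) * n ^ (p - 1) := by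
    intro q
    have hcard : (Finset.range (2 * M + 1) ×ˢ
        (Finset.univ : Finset ({m : Fin p // m ≠ q.1} → Fin n))).card =
        (2 * M + 1) * n ^ (p - 1) := by
      rw [Finset.card_product, Finset.card_range, Finset.card_univ, Fintype.card_fun,
        Fintype.card_fin, Fintype.card_subtype_compl, Fintype.card_fin]
      simp
    rw [← hcard]
    refine Finset.card_le_card_of_injOn
      (fun x => ((x q.1 : ℕ) + M - x q.2, fun m => x m.1)) ?_ ?_
    · intro x hx
      simp only [B, Finset.coe_filter, Finset.mem_univ, true_and, Set.mem_ofPred_eq] at hx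
      simp only [Finset.coe_product, Set.mem_prod, Finset.mem_coe, Finset.mem_range,
        Finset.mem_univ, and_true]
      omega
    · intro x hx y hy hxy
      simp only [B, Finset.coe_filter, Finset.mem_univ, true_and, Set.mem_ofPred_eq] at hx hy
      obtain ⟨h1, h2⟩ := Prod.mk.inj hxy
      have h3 : ∀ m, m ≠ q.1 → x m = y m := fun m hm => congrFun h2 ⟨m, hm⟩
      funext m
      by_cases hm : m = q.1
      · subst hm
        have h4 := h3 q.2 (Ne.symm hx.1)
        rw [h4] at h1 hx
        exact Fin.ext (by omega)
      · exact h3 m hm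
  calc _ ≤ (Finset.univ.biUnion B).card := Finset.card_le_card hsub
    _ ≤ ∑ q, (B q).card := Finset.card_biUnion_le
    _ ≤ ∑ q : Fin p × Fin p, (2 * M + 1) * n ^ (p - 1) := Finset.sum_le_sum fun q _ => hB q
    _ = _ := by simp

open Classical in
/-- Replacing the signed count by its value on separated tuples and the sum over injections by
the sum over all tuples only costs the number of non-separated tuples. -/
lemma abs_sum_signedShiftCount_sub_le (e : Fin p ↪ Fin n) {M : ℕ} {k l : Fin p → ℕ}
    (hk : ∀ i, k i ≤ M) (hl : ∀ i, l i ≤ M) {C : ℝ} {G : (Fin p → Fin n) → ℝ}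
    (hG : ∀ x, |G x| ≤ C) :
    |(n.factorial : ℝ)⁻¹ * ∑ σ : Equiv.Perm (Fin n),
        signedShiftCount (Function.extend e k 0) (Function.extend e l 0) σ *
          G (fun i => σ (e i)) -
      (n.descFactorial p : ℝ)⁻¹ * ((if k = l then 1 else 0) * ∑ x, G x)| ≤
      (n.descFactorial p : ℝ)⁻¹ * (2 * C *
        (Finset.univ.filter fun x : Fin p → Fin n => ¬ IsSeparatedBy M x).card) := by
  have hD : (0 : ℝ) < n.descFactorial p := by
    have : p ≤ n := by simpa using Fintype.card_le_of_embedding e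
    exact_mod_cast Nat.descFactorial_pos.mpr this
  have hn : (0 : ℝ) < n.factorial := by exact_mod_cast n.factorial_pos
  set δ : ℝ := if k = l then 1 else 0 with hδ
  have hδ1 : |δ| ≤ 1 := by rw [hδ]; split_ifs <;> simp
  have havg : ∀ F : (Fin p → Fin n) → ℝ,
      (n.factorial : ℝ)⁻¹ * ∑ σ : Equiv.Perm (Fin n), F (fun i => σ (e i)) =
        (n.descFactorial p : ℝ)⁻¹ * ∑ x : Fin p ↪ Fin n, F x := fun F => by
    have := sum_perm_comp_embedding e F
    field_simp
    linarith
  set bad : (Fin p → Fin n) → ℝ := fun x => if IsSeparatedBy M x then 0 else C with hbad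
  set good : (Fin p → Fin n) → ℝ := fun x => if IsSeparatedBy M x then δ * G x else 0 with hgood
  have hC : ∀ x : Fin p → Fin n, 0 ≤ C := fun x => (abs_nonneg _).trans (hG x)
  have hbad0 : ∀ x, 0 ≤ bad x := fun x => by
    simp only [hbad]; split_ifs
    · exact le_rfl
    · exact hC x
  have hbadsum : ∑ x, bad x =
      C * (Finset.univ.filter fun x : Fin p → Fin n => ¬ IsSeparatedBy M x).card := by
    simp only [hbad]
    rw [Finset.sum_ite]
    simp [mul_comm]
  have h1 : |∑ σ : Equiv.Perm (Fin n),
        (signedShiftCount (Function.extend e k 0) (Function.extend e l 0) σ : ℝ) *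
          G (fun i => σ (e i)) - ∑ σ : Equiv.Perm (Fin n), good (fun i => σ (e i))| ≤
      ∑ σ : Equiv.Perm (Fin n), bad (fun i => σ (e i)) := by
    rw [← Finset.sum_sub_distrib]
    refine (Finset.abs_sum_le_sum_abs _ _).trans (Finset.sum_le_sum fun σ _ => ?_)
    by_cases hs : IsSeparatedBy M fun i => σ (e i)
    · simp only [hbad, hgood, if_pos hs]
      rw [signedShiftCount_of_isSeparatedBy e hk hl σ hs]
      simp [hδ]
    · simp only [hbad, hgood, if_neg hs, sub_zero, abs_mul]
      have := abs_signedShiftCount_le_one (Function.extend e k 0) (Function.extend e l 0) σ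
      have : |(signedShiftCount (Function.extend e k 0) (Function.extend e l 0) σ : ℝ)| ≤ 1 := by
        exact_mod_cast this
      nlinarith [hG fun i => σ (e i), abs_nonneg (G fun i => σ (e i))]
  have h2 : |∑ x, good x - δ * ∑ x, G x| ≤ ∑ x, bad x := by
    rw [Finset.mul_sum, ← Finset.sum_sub_distrib]
    refine (Finset.abs_sum_le_sum_abs _ _).trans (Finset.sum_le_sum fun x _ => ?_)
    by_cases hs : IsSeparatedBy M x
    · simp [hbad, hgood, if_pos hs]
    · simp only [hbad, hgood, if_neg hs, zero_sub, abs_neg, abs_mul]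
      nlinarith [hG x, abs_nonneg (G x)]
  have h3 : ∑ x : Fin p ↪ Fin n, good x = ∑ x, good x := sum_embedding_eq_sum fun x hx => by
    simp only [hgood]
    rw [if_neg fun hs => hx hs.injective]
  have h4 := havg good
  have h5 := havg bad
  have h6 : (n.factorial : ℝ)⁻¹ * ∑ σ : Equiv.Perm (Fin n), bad (fun i => σ (e i)) ≤
      (n.descFactorial p : ℝ)⁻¹ * ∑ x, bad x := by
    rw [h5]
    exact mul_le_mul_of_nonneg_left (sum_embedding_le_sum hbad0) (by positivity)
  have h7 := mul_le_mul_of_nonneg_left h1 (inv_nonneg.mpr hn.le)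
  have h8 := mul_le_mul_of_nonneg_left h2 (inv_nonneg.mpr hD.le)
  rw [← abs_of_nonneg (inv_nonneg.mpr hn.le), ← abs_mul, abs_of_nonneg (inv_nonneg.mpr hn.le),
    mul_sub, h4, h3] at h7
  rw [← abs_of_nonneg (inv_nonneg.mpr hD.le), ← abs_mul, abs_of_nonneg (inv_nonneg.mpr hD.le),
    mul_sub] at h8
  refine (abs_sub_le _ _ _).trans ((add_le_add (h7.trans h6) h8).trans (le_of_eq ?_))
  rw [hbadsum]
  ring

end Combinatorics

section Asymptotics

open Topology

lemma sum_range_ginibreRatio {b : ℝ} (hb : b ≠ 0) (a : ℝ) (k N : ℕ) :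
    b⁻¹ * ∑ m ∈ Finset.range N, ginibreRatio b a k m =
      (∏ r ∈ Finset.range (k + 1), (N + r + a) / b -
        ∏ r ∈ Finset.range (k + 1), (r + a) / b) / (k + 1) := by
  have hk : (k : ℝ) + 1 ≠ 0 := by positivity
  induction N with
  | zero => simp
  | succ N ih =>
    rw [Finset.sum_range_succ, mul_add, ih,
      Finset.prod_range_succ (fun r : ℕ => (((N + 1 : ℕ) : ℝ) + r + a) / b),
      Finset.prod_range_succ' (fun r : ℕ => ((N : ℝ) + r + a) / b)]
    have h : ∀ r ∈ Finset.range k, (((N + 1 : ℕ) : ℝ) + r + a) / b = (N + r + 1 + a) / b :=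
      fun r _ => by push_cast; ring
    have h' : ∀ r ∈ Finset.range k, ((N : ℝ) + (r + 1 : ℕ) + a) / b = (N + r + 1 + a) / b :=
      fun r _ => by push_cast; ring
    rw [Finset.prod_congr rfl h, Finset.prod_congr rfl h', ginibreRatio]
    push_cast
    field_simp
    ring

lemma tendsto_average_ginibreRatio (c : ℝ) (k : ℕ) :
    Tendsto (fun n : ℕ => (n : ℝ)⁻¹ * ∑ m : Fin n, ginibreRatio n ((c - 1) * n) k m) atTop
      (𝓝 ((c ^ (k + 1) - (c - 1) ^ (k + 1)) / (k + 1))) := by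
  have h : ∀ x : ℝ, Tendsto (fun n : ℕ => ∏ r ∈ Finset.range (k + 1), (x + r / n)) atTop
      (𝓝 (x ^ (k + 1))) := by
    intro x
    have : Tendsto (fun n : ℕ => ∏ r ∈ Finset.range (k + 1), (x + r / (n : ℝ))) atTop
        (𝓝 (∏ _r ∈ Finset.range (k + 1), (x + 0))) :=
      tendsto_finsetProd _ fun r _ =>
        tendsto_const_nhds.add (tendsto_const_div_atTop_nhds_zero_nat (r : ℝ))
    simpa using this
  refine (((h c).sub (h (c - 1))).div_const ((k : ℝ) + 1)).congr' ?_
  filter_upwards [eventually_ge_atTop 1] with n hn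
  have hn' : (n : ℝ) ≠ 0 := by positivity
  rw [Fin.sum_univ_eq_sum_range (fun m => ginibreRatio n ((c - 1) * n) k m) n,
    sum_range_ginibreRatio hn']
  congr 2
  · exact Finset.prod_congr rfl fun r _ => by field_simp; ring
  · exact Finset.prod_congr rfl fun r _ => by field_simp; ring

lemma ginibreRatio_nonneg {c : ℝ} (hc : 1 ≤ c) (n k m : ℕ) :
    0 ≤ ginibreRatio n ((c - 1) * n) k m := by
  have : 0 ≤ c - 1 := by linarith
  unfold ginibreRatio
  positivity

lemma ginibreRatio_le {c : ℝ} (hc : 1 ≤ c) {n m : ℕ} (hm : m < n) (k : ℕ) :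
    ginibreRatio n ((c - 1) * n) k m ≤ (c + k) ^ k := by
  have hn : (1 : ℝ) ≤ n := by exact_mod_cast (Nat.one_le_iff_ne_zero.mpr (by omega))
  have hc' : 0 ≤ c - 1 := by linarith
  unfold ginibreRatio
  refine (Finset.prod_le_prod (g := fun _ => c + (k : ℝ)) (fun r _ => by positivity)
    fun r hr => ?_).trans_eq (by simp)
  rw [div_le_iff₀ (by linarith)]
  have h1 : (m : ℝ) + 1 ≤ n := by exact_mod_cast hm
  have h2 : (r : ℝ) ≤ k := by exact_mod_cast (Finset.mem_range.mp hr).le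
  have h3 : (k : ℝ) ≤ k * n := le_mul_of_one_le_right (by positivity) hn
  nlinarith

variable {c : ℝ} {μ : ∀ n : ℕ, Measure (Fin n → ℂ)}

lemma abs_prod_ginibreRatio_le (hc : 1 ≤ c) {n p : ℕ} (k : Fin p → ℕ) (x : Fin p → Fin n) :
    |∏ j, ginibreRatio n ((c - 1) * n) (k j) (x j)| ≤ ∏ j, (c + k j) ^ k j := by
  rw [abs_of_nonneg (Finset.prod_nonneg fun j _ => ginibreRatio_nonneg hc _ _ _)]
  exact Finset.prod_le_prod (fun j _ => ginibreRatio_nonneg hc _ _ _)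
    fun j _ => ginibreRatio_le hc (x j).2 _

lemma tendsto_pow_div_descFactorial (p : ℕ) :
    Tendsto (fun n : ℕ => (n : ℝ) ^ p / (n.descFactorial p : ℝ)) atTop (𝓝 1) := by
  have h := (isEquivalent_descFactorial p).symm
  refine (Asymptotics.isEquivalent_iff_tendsto_one ?_).mp h
  filter_upwards [eventually_ge_atTop p] with n hn
  exact_mod_cast (Nat.descFactorial_pos.mpr hn).ne'

lemma prod_pow_mul_conj_pow_extend {n p : ℕ} (e : Fin p ↪ Fin n) (k l : Fin p → ℕ)
    (y : Fin n → ℂ) :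
    ∏ j, y (e j) ^ k j * (starRingEnd ℂ) (y (e j)) ^ l j =
      ∏ i, y i ^ Function.extend e k 0 i *
        (starRingEnd ℂ) (y i) ^ Function.extend e l 0 i := by
  refine Fintype.prod_of_injective e e.injective _ _ (fun i hi => ?_) fun j => ?_
  · rw [Function.extend_apply' _ _ _ hi, Function.extend_apply' _ _ _ hi]
    simp
  · rw [e.injective.extend_apply, e.injective.extend_apply]

lemma prod_ginibreRatio_extend {n p : ℕ} (b a : ℝ) (e : Fin p ↪ Fin n) (k : Fin p → ℕ)
    (σ : Fin n → Fin n) :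
    ∏ i, ginibreRatio b a (Function.extend e k 0 i) (σ i) =
      ∏ j, ginibreRatio b a (k j) (σ (e j)) := by
  refine (Fintype.prod_of_injective e e.injective _ _ (fun i hi => ?_) fun j => ?_).symm
  · rw [Function.extend_apply' _ _ _ hi]
    simp [ginibreRatio]
  · rw [e.injective.extend_apply]

/-- `μ n` is the induced Ginibre ensemble with weight `|z|^{2(c-1)n} e^{-n|z|²}`. -/
def IsInducedGinibre (c : ℝ) (μ : ∀ n : ℕ, Measure (Fin n → ℂ)) : Prop :=
  ∀ n : ℕ, 1 ≤ n → ∃ K : ℝ, 0 < K ∧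
    μ n = volume.withDensity fun z => ENNReal.ofReal (ginibreDensity K n ((c - 1) * n) z)

lemma continuous_monomial {p : ℕ} (k l : Fin p → ℕ) :
    Continuous fun x : Fin p → ℂ => ∏ j, x j ^ k j * (starRingEnd ℂ) (x j) ^ l j := by
  have := Complex.continuous_conj
  fun_prop

lemma measurable_comp_embedding {n p : ℕ} (e : Fin p ↪ Fin n) :
    Measurable fun (y : Fin n → ℂ) (j : Fin p) => y (e j) :=
  measurable_pi_lambda _ fun j => measurable_pi_apply (e j)

lemma integrable_monomial_map (hc : 1 ≤ c) (hμ : IsInducedGinibre c μ)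
    {n p : ℕ} (hn : 1 ≤ n) (e : Fin p ↪ Fin n) (k l : Fin p → ℕ) :
    Integrable (fun x : Fin p → ℂ => ∏ j, x j ^ k j * (starRingEnd ℂ) (x j) ^ l j)
      ((μ n).map fun y j => y (e j)) := by
  obtain ⟨K, hK, hμn⟩ := hμ n hn
  rw [integrable_map_measure (continuous_monomial k l).aestronglyMeasurable
    (measurable_comp_embedding e).aemeasurable]
  have hc' : 0 ≤ c - 1 := by linarith
  simp only [Function.comp_def, prod_pow_mul_conj_pow_extend]
  exact integrable_monomial (by exact_mod_cast hn) (by positivity) hK hμn _ _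

lemma integral_monomial_map [∀ n, IsProbabilityMeasure (μ n)] (hc : 1 ≤ c)
    (hμ : IsInducedGinibre c μ) {n p : ℕ} (hn : 1 ≤ n) (e : Fin p ↪ Fin n) (k l : Fin p → ℕ) :
    ∫ x, ∏ j, x j ^ k j * (starRingEnd ℂ) (x j) ^ l j ∂((μ n).map fun y j => y (e j)) =
      (((n.factorial : ℝ)⁻¹ * ∑ σ : Equiv.Perm (Fin n),
        signedShiftCount (Function.extend e k 0) (Function.extend e l 0) σ *
          ∏ j, ginibreRatio n ((c - 1) * n) (k j) (σ (e j)) : ℝ) : ℂ) := by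
  obtain ⟨K, hK, hμn⟩ := hμ n hn
  have hc' : 0 ≤ c - 1 := by linarith
  have hb : (0 : ℝ) < n := by exact_mod_cast hn
  have ha : 0 ≤ (c - 1) * n := by positivity
  rw [integral_map (measurable_comp_embedding e).aemeasurable
    (continuous_monomial k l).aestronglyMeasurable]
  simp only [prod_pow_mul_conj_pow_extend]
  rw [integral_monomial_eq_sum_signedShiftCount hb ha hK hμn, normalization_eq hb ha hK hμn]
  simp only [prod_ginibreRatio_extend]

lemma integral_monomial_pi_annulusUniform (hc : 1 ≤ c) {p : ℕ} (k l : Fin p → ℕ) :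
    ∫ x, ∏ j, x j ^ k j * (starRingEnd ℂ) (x j) ^ l j
        ∂(Measure.pi fun _ : Fin p => annulusUniform c) =
      (((if k = l then 1 else 0) *
        ∏ j, ((c ^ (k j + 1) - (c - 1) ^ (k j + 1)) / (k j + 1)) : ℝ) : ℂ) := by
  have := isProbabilityMeasure_annulusUniform hc
  rw [integral_fintype_prod_eq_prod fun j (z : ℂ) => z ^ k j * (starRingEnd ℂ) z ^ l j]
  simp only [integral_annulusUniform hc]
  split_ifs with h
  · subst h
    simp
  · obtain ⟨j, hj⟩ := Function.ne_iff.mp h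
    rw [Finset.prod_eq_zero (Finset.mem_univ j) (if_neg hj)]
    simp

theorem tendsto_integral_monomial [∀ n, IsProbabilityMeasure (μ n)] (hc : 1 ≤ c)
    (hμ : IsInducedGinibre c μ) {p : ℕ} (k l : Fin p → ℕ) :
    Tendsto (fun n : ℕ => if h : p ≤ n then
        ∫ x, ∏ j, x j ^ k j * (starRingEnd ℂ) (x j) ^ l j
          ∂((μ n).map fun y j => y (Fin.castLE h j)) else 0) atTop
      (𝓝 (∫ x, ∏ j, x j ^ k j * (starRingEnd ℂ) (x j) ^ l j
        ∂(Measure.pi fun _ : Fin p => annulusUniform c))) := by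
  classical
  rw [integral_monomial_pi_annulusUniform hc]
  set C : ℝ := ∏ j, (c + k j) ^ k j with hC
  set M : ℕ := ∑ j, (k j + l j) with hM
  have hkl : ∀ j, k j + l j ≤ M := fun j =>
    Finset.single_le_sum (f := fun j => k j + l j) (fun _ _ => Nat.zero_le _) (Finset.mem_univ j)
  have hC0 : 0 ≤ C := Finset.prod_nonneg fun j _ => by positivity
  let m : ℕ → ℝ := fun n => (n.descFactorial p : ℝ)⁻¹ * ((if k = l then 1 else 0) *
    ∑ x : Fin p → Fin n, ∏ j, ginibreRatio n ((c - 1) * n) (k j) (x j))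
  have hm : Tendsto m atTop (𝓝 ((if k = l then 1 else 0) *
      ∏ j, ((c ^ (k j + 1) - (c - 1) ^ (k j + 1)) / (k j + 1)))) := by
    have h1 := (tendsto_pow_div_descFactorial p).mul
      ((tendsto_const_nhds (x := if k = l then (1 : ℝ) else 0)).mul
        (tendsto_finsetProd Finset.univ fun j _ => tendsto_average_ginibreRatio c (k j)))
    rw [one_mul] at h1
    refine h1.congr' ?_
    filter_upwards [eventually_ge_atTop 1] with n hn
    have hn' : (n : ℝ) ≠ 0 := by positivity
    simp only [m]
    rw [Finset.prod_mul_distrib, Finset.prod_const, Finset.card_univ, Fintype.card_fin,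
      Finset.prod_univ_sum, Fintype.piFinset_univ, inv_pow, div_eq_mul_inv]
    have hp : (n : ℝ) ^ p * ((n : ℝ) ^ p)⁻¹ = 1 := mul_inv_cancel₀ (pow_ne_zero _ hn')
    linear_combination ((n.descFactorial p : ℝ)⁻¹ * ((if k = l then 1 else 0) *
      ∑ x : Fin p → Fin n, ∏ j, ginibreRatio n ((c - 1) * n) (k j) (x j))) * hp
  have herr : Tendsto (fun n : ℕ => (n : ℝ) ^ p / (n.descFactorial p : ℝ) *
      ((2 * C * (p * p * (2 * M + 1))) / n)) atTop (𝓝 0) := by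
    simpa using (tendsto_pow_div_descFactorial p).mul
      (tendsto_const_div_atTop_nhds_zero_nat (2 * C * (p * p * (2 * M + 1))))
  have hm' := (Complex.continuous_ofReal.tendsto _).comp hm
  refine hm'.congr_dist (squeeze_zero' (Eventually.of_forall fun _ => dist_nonneg) ?_ herr)
  filter_upwards [eventually_ge_atTop 1, eventually_ge_atTop p] with n hn hpn
  have hn' : (n : ℝ) ≠ 0 := by positivity
  rw [dif_pos hpn]
  have hint := integral_monomial_map hc hμ hn (Fin.castLEEmb hpn) k l
  simp only [Fin.coe_castLEEmb] at hint
  rw [hint, dist_comm, Function.comp_apply, dist_eq_norm, ← Complex.ofReal_sub, Complex.norm_real]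
  have hmain := abs_sum_signedShiftCount_sub_le (Fin.castLEEmb hpn)
    (fun j => (Nat.le_add_right _ _).trans (hkl j)) (fun j => (Nat.le_add_left _ _).trans (hkl j))
    (G := fun x => ∏ j, ginibreRatio n ((c - 1) * n) (k j) (x j))
    (fun x => abs_prod_ginibreRatio_le hc k x)
  refine hmain.trans ?_
  have hcard : ((Finset.univ.filter fun x : Fin p → Fin n => ¬ IsSeparatedBy M x).card : ℝ) ≤
      p * p * ((2 * M + 1) * n ^ (p - 1)) := by exact_mod_cast card_not_isSeparatedBy_le M
  have hpow : (p : ℝ) * (n : ℝ) ^ (p - 1) = p * n ^ p / n := by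
    rcases p with _ | p
    · simp
    · rw [Nat.add_sub_cancel, pow_succ]
      field_simp
  calc _ ≤ (n.descFactorial p : ℝ)⁻¹ * (2 * C * (p * p * ((2 * M + 1) * n ^ (p - 1)))) := by
        gcongr
    _ = (n.descFactorial p : ℝ)⁻¹ * (2 * C * (p * (2 * M + 1) * (p * n ^ (p - 1)))) := by ring
    _ = _ := by rw [hpow]; ring

end Asymptotics

section WeakConvergence

open Topology

variable {p : ℕ}

/-- The `j`-th coordinate function on `ℂᵖ`. -/
def coordinateMap (j : Fin p) : C(Fin p → ℂ, ℂ) := ⟨fun x => x j, continuous_apply j⟩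

/-- The star algebra of polynomials in the coordinates of `ℂᵖ` and their conjugates. -/
noncomputable def starPolynomials (p : ℕ) : StarSubalgebra ℂ C(Fin p → ℂ, ℂ) :=
  StarAlgebra.adjoin ℂ (Set.range coordinateMap)

lemma coordinateMap_mem_starPolynomials (j : Fin p) : coordinateMap j ∈ starPolynomials p :=
  StarAlgebra.subset_adjoin ℂ _ ⟨j, rfl⟩

lemma starPolynomials_induction {P : C(Fin p → ℂ, ℂ) → Prop}
    (monomial : ∀ (k l : Fin p → ℕ) (g : C(Fin p → ℂ, ℂ)),
      (∀ x, g x = ∏ j, x j ^ k j * (starRingEnd ℂ) (x j) ^ l j) → P g)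
    (zero : P 0) (sum : ∀ g h, P g → P h → P (g + h)) (smul : ∀ (a : ℂ) g, P g → P (a • g))
    {g : C(Fin p → ℂ, ℂ)} (hg : g ∈ starPolynomials p) : P g := by
  have hg' : g ∈ Subalgebra.toSubmodule (starPolynomials p).toSubalgebra := hg
  rw [starPolynomials, StarAlgebra.adjoin_toSubalgebra, Algebra.adjoin_eq_span] at hg'
  refine Submodule.span_induction (p := fun g _ => P g) (fun g hg => ?_) zero
    (fun g h _ _ => sum g h) (fun a g _ => smul a g) hg'
  have : ∃ k l : Fin p → ℕ, ∀ x, g x = ∏ j, x j ^ k j * (starRingEnd ℂ) (x j) ^ l j := by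
    refine Submonoid.closure_induction (motive := fun g _ => ∃ k l : Fin p → ℕ, ∀ x,
      g x = ∏ j, x j ^ k j * (starRingEnd ℂ) (x j) ^ l j) (fun g hg => ?_) ?_ ?_ hg
    · rcases hg with ⟨i, rfl⟩ | ⟨i, hi⟩
      · refine ⟨Pi.single i 1, 0, fun x => ?_⟩
        rw [Finset.prod_eq_single i]
        · simp [coordinateMap]
        · intro j _ hj
          simp [Pi.single_eq_of_ne hj]
        · simp
      · refine ⟨0, Pi.single i 1, fun x => ?_⟩
        rw [← star_star g, ← hi, Finset.prod_eq_single i]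
        · simp [coordinateMap]
        · intro j _ hj
          simp [Pi.single_eq_of_ne hj]
        · simp
    · exact ⟨0, 0, fun x => by simp⟩
    · rintro g h _ _ ⟨k, l, hg⟩ ⟨k', l', hh⟩
      refine ⟨k + k', l + l', fun x => ?_⟩
      rw [ContinuousMap.mul_apply, hg, hh, ← Finset.prod_mul_distrib]
      refine Finset.prod_congr rfl fun j _ => ?_
      simp only [Pi.add_apply, pow_add]
      ring
  obtain ⟨k, l, h⟩ := this
  exact monomial k l g h

lemma exists_starPolynomial_norm_sub_lt (f : C(Fin p → ℂ, ℂ)) {K : Set (Fin p → ℂ)}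
    (hK : IsCompact K) {ε : ℝ} (hε : 0 < ε) :
    ∃ g ∈ starPolynomials p, ∀ x ∈ K, ‖f x - g x‖ < ε := by
  have : CompactSpace K := isCompact_iff_compactSpace.mp hK
  let incl : C(K, Fin p → ℂ) := ⟨Subtype.val, continuous_subtype_val⟩
  let res := ContinuousMap.compStarAlgHom' ℂ ℂ incl
  have hsep : ((starPolynomials p).map res).SeparatesPoints := by
    intro x y hxy
    obtain ⟨j, hj⟩ := Function.ne_iff.mp (Subtype.coe_injective.ne hxy)
    exact ⟨_, ⟨res (coordinateMap j), ⟨_, coordinateMap_mem_starPolynomials j, rfl⟩, rfl⟩, hj⟩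
  have htop := ContinuousMap.starSubalgebra_topologicalClosure_eq_top_of_separatesPoints _ hsep
  have hmem : res f ∈ closure (((starPolynomials p).map res : StarSubalgebra ℂ C(K, ℂ)) :
      Set C(K, ℂ)) := by
    rw [← StarSubalgebra.topologicalClosure_coe, htop]
    trivial
  obtain ⟨_, ⟨g, hg, rfl⟩, hdist⟩ := Metric.mem_closure_iff.mp hmem ε hε
  refine ⟨g, hg, fun x hx => ?_⟩
  rw [← dist_eq_norm]
  exact (ContinuousMap.dist_apply_le_dist (f := res f) (g := res g) ⟨x, hx⟩).trans_lt hdist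

lemma integrable_of_continuous_of_ae_norm_le {ρ : Measure (Fin p → ℂ)} [IsFiniteMeasure ρ] {R : ℝ}
    (hR : ∀ᵐ x ∂ρ, ‖x‖ ≤ R) {g : (Fin p → ℂ) → ℂ} (hg : Continuous g) : Integrable g ρ := by
  obtain ⟨C, hC⟩ := (isCompact_closedBall (0 : Fin p → ℂ) R).exists_bound_of_continuousOn
    hg.continuousOn
  refine Integrable.of_bound hg.aestronglyMeasurable C ?_
  filter_upwards [hR] with x hx using hC x (by simpa using hx)

variable {ν : ℕ → Measure (Fin p → ℂ)} {ρ : Measure (Fin p → ℂ)}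

lemma integrable_and_tendsto_starPolynomial
    (hint : ∀ n (k l : Fin p → ℕ),
      Integrable (fun x => ∏ j, x j ^ k j * (starRingEnd ℂ) (x j) ^ l j) (ν n))
    (hintρ : ∀ k l : Fin p → ℕ,
      Integrable (fun x => ∏ j, x j ^ k j * (starRingEnd ℂ) (x j) ^ l j) ρ)
    (hlim : ∀ k l : Fin p → ℕ,
      Tendsto (fun n => ∫ x, ∏ j, x j ^ k j * (starRingEnd ℂ) (x j) ^ l j ∂(ν n)) atTop
        (𝓝 (∫ x, ∏ j, x j ^ k j * (starRingEnd ℂ) (x j) ^ l j ∂ρ)))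
    {g : C(Fin p → ℂ, ℂ)} (hg : g ∈ starPolynomials p) :
    (∀ n, Integrable g (ν n)) ∧ Integrable g ρ ∧
      Tendsto (fun n => ∫ x, g x ∂(ν n)) atTop (𝓝 (∫ x, g x ∂ρ)) := by
  refine starPolynomials_induction (P := fun g => (∀ n, Integrable g (ν n)) ∧ Integrable g ρ ∧
      Tendsto (fun n => ∫ x, g x ∂(ν n)) atTop (𝓝 (∫ x, g x ∂ρ))) ?_ ?_ ?_ ?_ hg
  · intro k l g hg
    rw [show (g : (Fin p → ℂ) → ℂ) = _ from funext hg]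
    exact ⟨fun n => hint n k l, hintρ k l, hlim k l⟩
  · simp only [ContinuousMap.coe_zero, Pi.zero_apply, integral_zero]
    exact ⟨fun n => integrable_zero _ _ _, integrable_zero _ _ _, tendsto_const_nhds⟩
  · rintro g h ⟨hg1, hg2, hg3⟩ ⟨hh1, hh2, hh3⟩
    refine ⟨fun n => (hg1 n).add (hh1 n), hg2.add hh2, ?_⟩
    simp only [ContinuousMap.add_apply]
    rw [integral_add hg2 hh2]
    simpa only [integral_add (hg1 _) (hh1 _)] using hg3.add hh3
  · rintro a g ⟨hg1, hg2, hg3⟩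
    refine ⟨fun n => (hg1 n).smul a, hg2.smul a, ?_⟩
    simp only [ContinuousMap.smul_apply, integral_smul]
    exact hg3.const_smul a

/-- Convergence of all mixed moments to those of a compactly supported measure implies
convergence of the integrals of bounded continuous functions. -/
theorem tendsto_integral_of_tendsto_monomial [∀ n, IsProbabilityMeasure (ν n)]
    [IsProbabilityMeasure ρ] {R : ℝ} (hR0 : 0 ≤ R) (hR : ∀ᵐ x ∂ρ, ‖x‖ ≤ R)
    (hint : ∀ n (k l : Fin p → ℕ),
      Integrable (fun x => ∏ j, x j ^ k j * (starRingEnd ℂ) (x j) ^ l j) (ν n))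
    (hlim : ∀ k l : Fin p → ℕ,
      Tendsto (fun n => ∫ x, ∏ j, x j ^ k j * (starRingEnd ℂ) (x j) ^ l j ∂(ν n)) atTop
        (𝓝 (∫ x, ∏ j, x j ^ k j * (starRingEnd ℂ) (x j) ^ l j ∂ρ)))
    {f : (Fin p → ℂ) → ℝ} (hf : Continuous f) {B : ℝ} (hB : ∀ x, |f x| ≤ B) :
    Tendsto (fun n => ∫ x, f x ∂(ν n)) atTop (𝓝 (∫ x, f x ∂ρ)) := by
  have hintρ : ∀ k l : Fin p → ℕ,
      Integrable (fun x => ∏ j, x j ^ k j * (starRingEnd ℂ) (x j) ^ l j) ρ := fun k l =>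
    integrable_of_continuous_of_ae_norm_le hR (continuous_monomial k l)
  have hB0 : 0 ≤ B := (abs_nonneg _).trans (hB 0)
  let F : C(Fin p → ℂ, ℂ) := ⟨fun x => (f x : ℂ), Complex.continuous_ofReal.comp hf⟩
  have hFint : ∀ (κ : Measure (Fin p → ℂ)) [IsProbabilityMeasure κ], Integrable F κ :=
    fun κ _ => Integrable.of_bound F.continuous.aestronglyMeasurable B
      (Eventually.of_forall fun x => by simpa [F] using hB x)
  have hFB : ∀ x, ‖F x‖ ≤ B := fun x => by simpa [F] using hB x
  suffices h : Tendsto (fun n => ∫ x, F x ∂(ν n)) atTop (𝓝 (∫ x, F x ∂ρ)) by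
    have h' := (Complex.continuous_re.tendsto _).comp h
    simpa only [F, ContinuousMap.coe_mk, integral_complex_ofReal, Function.comp_def,
      Complex.ofReal_re] using h'
  rw [Metric.tendsto_atTop]
  intro ε hε
  obtain ⟨g, hg, hgF⟩ := exists_starPolynomial_norm_sub_lt F
    (isCompact_closedBall (0 : Fin p → ℂ) (R + 1)) (show 0 < ε / 8 by positivity)
  have hR1 : 0 < R + 1 := by linarith
  obtain ⟨G, hG⟩ := (isCompact_closedBall (0 : Fin p → ℂ) R).exists_bound_of_continuousOn
    g.continuous.continuousOn
  have hG0 : 0 ≤ G := (norm_nonneg _).trans (hG 0 (by simpa using hR0))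
  let q : ℝ := (R / (R + 1)) ^ 2
  have hq0 : 0 ≤ q := by positivity
  have hq1 : q < 1 := by
    have : R / (R + 1) < 1 := by rw [div_lt_one hR1]; linarith
    exact pow_lt_one₀ (by positivity) this (by norm_num)
  have hqlim : Tendsto (fun m : ℕ => (B + 1 + G ^ 2) * (p * q ^ m)) atTop (𝓝 0) := by
    simpa using ((tendsto_pow_atTop_nhds_zero_of_lt_one hq0 hq1).const_mul (p : ℝ)).const_mul
      (B + 1 + G ^ 2)
  obtain ⟨m, hm⟩ := (hqlim.eventually (gt_mem_nhds (show 0 < ε / 8 by positivity))).exists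
  let T : C(Fin p → ℂ, ℂ) := (algebraMap ℂ C(Fin p → ℂ, ℂ) ((B + 1 : ℝ) : ℂ) + g * star g) *
    ∑ j, ((((R + 1) ^ 2)⁻¹ : ℝ) : ℂ) ^ m • (coordinateMap j * star (coordinateMap j)) ^ m
  have hTmem : T ∈ starPolynomials p := by
    refine mul_mem (add_mem (algebraMap_mem _ _) (mul_mem hg (star_mem hg)))
      (sum_mem fun j _ => SMulMemClass.smul_mem _ (pow_mem (mul_mem ?_ (star_mem ?_)) _)) <;>
    exact coordinateMap_mem_starPolynomials j
  have hTval : ∀ x, T x = (((B + 1 + ‖g x‖ ^ 2) *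
      ∑ j, ((‖x j‖ / (R + 1)) ^ 2) ^ m : ℝ) : ℂ) := by
    intro x
    have h1 : ∀ w : ℂ, w * (starRingEnd ℂ) w = ((‖w‖ ^ 2 : ℝ) : ℂ) := fun w => by
      rw [Complex.mul_conj, Complex.normSq_eq_norm_sq]
    simp only [T, ContinuousMap.mul_apply, ContinuousMap.add_apply, ContinuousMap.coe_sum,
      Finset.sum_apply, ContinuousMap.smul_apply, ContinuousMap.pow_apply,
      ContinuousMap.star_apply, coordinateMap, ContinuousMap.coe_mk, algebraMap_apply,
      smul_eq_mul, mul_one, ← starRingEnd_apply, h1]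
    push_cast
    congr 1
    refine Finset.sum_congr rfl fun j _ => ?_
    rw [div_pow, div_pow, div_eq_mul_inv, mul_comm, inv_pow]
  have hTre : ∀ x, 0 ≤ (T x).re := fun x => by
    rw [hTval, Complex.ofReal_re]
    positivity
  have hbound : ∀ x, ‖F x - g x‖ ≤ ε / 8 + (T x).re := by
    intro x
    by_cases hx : x ∈ Metric.closedBall 0 (R + 1)
    · linarith [hgF x hx, hTre x]
    · have hx' : R + 1 < ‖x‖ := by simpa using hx
      have hex : ∃ j, R + 1 < ‖x j‖ := by
        by_contra! hcon
        exact absurd ((pi_norm_le_iff_of_nonneg hR1.le).mpr hcon) (not_le.mpr hx')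
      obtain ⟨j, hj⟩ := hex
      have h1 : 1 ≤ ∑ j, ((‖x j‖ / (R + 1)) ^ 2) ^ m := by
        refine le_trans ?_ (Finset.single_le_sum (f := fun j => ((‖x j‖ / (R + 1)) ^ 2) ^ m)
          (fun i _ => by positivity) (Finset.mem_univ j))
        exact one_le_pow₀ (one_le_pow₀ ((one_le_div hR1).mpr hj.le))
      rw [hTval, Complex.ofReal_re]
      have h2 : ‖F x - g x‖ ≤ B + ‖g x‖ := (norm_sub_le _ _).trans (by linarith [hFB x])
      have h3 : ‖g x‖ ≤ 1 + ‖g x‖ ^ 2 := by nlinarith [sq_nonneg (‖g x‖ - 1), norm_nonneg (g x)]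
      have h4 : 0 ≤ B + 1 + ‖g x‖ ^ 2 := by positivity
      nlinarith
  obtain ⟨hg1, hg2, hg3⟩ := integrable_and_tendsto_starPolynomial hint hintρ hlim hg
  obtain ⟨hT1, hT2, hT3⟩ := integrable_and_tendsto_starPolynomial hint hintρ hlim hTmem
  have hTρ : (∫ x, T x ∂ρ).re ≤ ε / 8 := by
    have hre : (∫ x, T x ∂ρ).re = ∫ x, (T x).re ∂ρ := (integral_re hT2).symm
    rw [hre]
    refine le_trans ?_ hm.le
    have : ∫ x, (T x).re ∂ρ ≤ ∫ _x, (B + 1 + G ^ 2) * (p * q ^ m) ∂ρ := by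
      refine integral_mono_ae hT2.re (integrable_const _) ?_
      filter_upwards [hR] with x hx
      change (T x).re ≤ _
      rw [hTval, Complex.ofReal_re]
      have h1 : ‖g x‖ ≤ G := hG x (by simpa using hx)
      have h2 : ∑ j, ((‖x j‖ / (R + 1)) ^ 2) ^ m ≤ ∑ _j : Fin p, q ^ m := by
        refine Finset.sum_le_sum fun j _ => ?_
        have : ‖x j‖ ≤ R := (norm_le_pi_norm x j).trans hx
        simp only [q]
        gcongr
      refine mul_le_mul (by gcongr) (h2.trans_eq (by simp)) ?_ ?_ <;> positivity
    simpa using this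
  have hdiff : ∀ (κ : Measure (Fin p → ℂ)) [IsProbabilityMeasure κ], Integrable g κ →
      Integrable T κ → ‖∫ x, F x ∂κ - ∫ x, g x ∂κ‖ ≤ ε / 8 + (∫ x, T x ∂κ).re := by
    intro κ _ hgκ hTκ
    have hre : (∫ x, T x ∂κ).re = ∫ x, (T x).re ∂κ := (integral_re hTκ).symm
    rw [← integral_sub (hFint κ) hgκ, hre]
    have hTre' : Integrable (fun x => (T x).re) κ := hTκ.re
    have h1 : ∫ x, (ε / 8 + (T x).re) ∂κ = ε / 8 + ∫ x, (T x).re ∂κ := by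
      rw [integral_add (integrable_const _) hTre']
      simp
    rw [← h1]
    exact norm_integral_le_of_norm_le ((integrable_const _).add hTre')
      (Eventually.of_forall hbound)
  have hTlim := (Complex.continuous_re.tendsto _).comp hT3
  obtain ⟨N₁, hN₁⟩ := (Metric.tendsto_atTop.mp hg3) (ε / 8) (by positivity)
  obtain ⟨N₂, hN₂⟩ := (Metric.tendsto_atTop.mp hTlim) (ε / 8) (by positivity)
  refine ⟨max N₁ N₂, fun n hn => ?_⟩
  have h1 := hN₁ n ((le_max_left _ _).trans hn)
  have h2 := hN₂ n ((le_max_right _ _).trans hn)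
  rw [Function.comp_apply, Real.dist_eq] at h2
  have h3 := hdiff (ν n) (hg1 n) (hT1 n)
  have h4 := hdiff ρ hg2 hT2
  have h5 := (abs_lt.mp h2).2
  rw [← dist_eq_norm] at h3 h4
  rw [dist_comm] at h4
  linarith [dist_triangle4 (∫ x, F x ∂(ν n)) (∫ x, g x ∂(ν n)) (∫ x, g x ∂ρ) (∫ x, F x ∂ρ)]

end WeakConvergence

/-- for the probability measures `μ n` on `ℂⁿ` with density proportional to
`exp(-n Σ |zᵢ|²) (∏ |zᵢ|)^{2(c-1)n} ∏_{i<j}|zᵢ-zⱼ|²`, the marginal on the first `p`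
coordinates converges as `n → ∞`, both in the weak* topology and in *-moments, to the product
`ρ^{⊗p}` of copies of the uniform distribution `ρ` on the annulus `√(c-1) < |z| < √c`. -/
theorem stmt_11 (c : ℝ) (hc : 1 ≤ c) (μ : ∀ n : ℕ, Measure (Fin n → ℂ))
    [∀ n, IsProbabilityMeasure (μ n)]
    (hμ : ∀ n : ℕ, 1 ≤ n → ∃ K : ℝ, 0 < K ∧
      μ n = volume.withDensity (fun z : Fin n → ℂ =>
        ENNReal.ofReal (K * Real.exp (-(n : ℝ) * ∑ i, ‖z i‖ ^ 2) *
          (∏ i, ‖z i‖) ^ (2 * (c - 1) * (n : ℝ)) *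
          ∏ i, ∏ j ∈ Finset.Ioi i, ‖z i - z j‖ ^ 2))) :
    ∀ p : ℕ,
      (∀ f : ZeroAtInftyContinuousMap (Fin p → ℂ) ℝ,
        Tendsto (fun n : ℕ =>
            if h : p ≤ n then
              ∫ x, f x ∂(Measure.map (fun (y : Fin n → ℂ) (j : Fin p) => y (Fin.castLE h j)) (μ n))
            else 0)
          atTop (nhds (∫ x, f x ∂(Measure.pi (fun _ : Fin p => annulusUniform c))))) ∧
      (∀ k ℓ : Fin p → ℕ,
        Tendsto (fun n : ℕ =>
            if h : p ≤ n then
              ∫ x, (∏ j, x j ^ k j * (starRingEnd ℂ) (x j) ^ ℓ j)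
                ∂(Measure.map (fun (y : Fin n → ℂ) (j : Fin p) => y (Fin.castLE h j)) (μ n))
            else 0)
          atTop (nhds (∫ x, (∏ j, x j ^ k j * (starRingEnd ℂ) (x j) ^ ℓ j)
            ∂(Measure.pi (fun _ : Fin p => annulusUniform c))))) := by
  have hμ' : IsInducedGinibre c μ := fun n hn => by
    obtain ⟨K, hK, h⟩ := hμ n hn
    refine ⟨K, hK, h.trans ?_⟩
    simp only [ginibreDensity, mul_assoc]
  intro p
  refine ⟨fun f => ?_, fun k ℓ => tendsto_integral_monomial hc hμ' k ℓ⟩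
  have := isProbabilityMeasure_annulusUniform hc
  rw [← tendsto_add_atTop_iff_nat (p + 1)]
  have hle : ∀ n, p ≤ n + (p + 1) := fun n => by omega
  simp only [dif_pos (hle _)]
  have hprob : ∀ n, IsProbabilityMeasure ((μ (n + (p + 1))).map
      fun (y : Fin (n + (p + 1)) → ℂ) (j : Fin p) => y (Fin.castLE (hle n) j)) := fun n =>
    Measure.isProbabilityMeasure_map
      (measurable_comp_embedding (Fin.castLEEmb (hle n))).aemeasurable
  refine tendsto_integral_of_tendsto_monomial (ν := fun n => (μ (n + (p + 1))).map
    fun (y : Fin (n + (p + 1)) → ℂ) (j : Fin p) => y (Fin.castLE (hle n) j))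
    (R := Real.sqrt c) (Real.sqrt_nonneg c) ?_
    (fun n k l => integrable_monomial_map hc hμ' (by omega) (Fin.castLEEmb (hle n)) k l)
    (fun k l => ?_) f.continuous (B := ‖f.toBCF‖) fun x => f.toBCF.norm_coe_le_norm x
  · have hall : ∀ᵐ x ∂(Measure.pi fun _ : Fin p => annulusUniform c), ∀ j, ‖x j‖ ≤ Real.sqrt c :=
      ae_all_iff.mpr fun j =>
        (measurePreserving_eval (fun _ : Fin p => annulusUniform c) j).quasiMeasurePreserving.ae
          (ae_norm_le_annulusUniform c)
    filter_upwards [hall] with x hx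
    exact (pi_norm_le_iff_of_nonneg (Real.sqrt_nonneg c)).mpr hx
  · have h := (tendsto_add_atTop_iff_nat (p + 1)).mpr (tendsto_integral_monomial hc hμ' k l)
    simpa only [dif_pos (hle _)] using h
end

section
/- Let c ≥ 1, n ∈ ℕ, and let μ be the probability measure on ℂ with density D(z) = (n^{(c−1)n}/π) · Σ_{k=0}^{n−1} [ n^k |z|^{2(k+(c−1)n)} / Γ(k+(c−1)n+1) ] · e^{−n|z|²} with respect to Lebesgue measure d(Re z)d(Im z) on ℂ. Then for every nonnegative integer b, ∫_ℂ |z|^{2b} dμ(z) = (1/(b+1)) · [ ∏_{i=0}^{b} (c + i/n) − ∏_{i=0}^{b} ((c−1) + i/n) ]. Consequently, ∫_ℂ |z|^{2b} dμ(z) → (c^{b+1} − (c−1)^{b+1})/(b+1) as n → ∞, which equals ∫_ℂ |z|^{2b} dρ(z) where ρ is the uniform distribution on the annulus {z ∈ ℂ : √(c−1) < |z| < √c}. -/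
open MeasureTheory Filter

theorem Real.Gamma_add_nat_add_one {s : ℝ} (hs : 0 ≤ s) (b : ℕ) :
    Real.Gamma (s + b + 1) = Real.Gamma (s + 1) * ∏ i ∈ Finset.range b, (s + 1 + i) := by
  induction b with
  | zero => simp
  | succ b ih =>
    rw [Finset.prod_range_succ, ← mul_assoc, ← ih, Real.Gamma_add_one (by positivity)]
    push_cast
    rw [show s + (b + 1 : ℝ) = s + b + 1 by ring]
    ring

theorem prod_range_shift_telescope (s : ℝ) (b : ℕ) :
    ((b : ℝ) + 1) * ∏ i ∈ Finset.range b, (s + 1 + i) =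
      ∏ i ∈ Finset.range (b + 1), (s + 1 + i) - ∏ i ∈ Finset.range (b + 1), (s + i) := by
  rw [Finset.prod_range_succ, Finset.prod_range_succ' (fun i : ℕ => s + (i : ℝ))]
  have : ∀ i : ℕ, s + ((i + 1 : ℕ) : ℝ) = s + 1 + i := fun i => by push_cast; ring
  simp only [this, Nat.cast_zero, add_zero]
  ring

theorem sum_prod_range_add (s : ℝ) (b n : ℕ) :
    ((b : ℝ) + 1) * ∑ k ∈ Finset.range n, ∏ i ∈ Finset.range b, (k + s + 1 + i) =
      ∏ i ∈ Finset.range (b + 1), (n + s + i) - ∏ i ∈ Finset.range (b + 1), (s + i) := by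
  have h := Finset.sum_range_sub (fun k : ℕ => ∏ i ∈ Finset.range (b + 1), ((k : ℝ) + s + i)) n
  simp only [Nat.cast_zero, zero_add] at h
  rw [← h, Finset.mul_sum]
  refine Finset.sum_congr rfl fun k _ => ?_
  rw [prod_range_shift_telescope]
  push_cast
  simp only [add_right_comm (k : ℝ) 1 s]

theorem integral_norm_rpow_mul_exp {s a : ℝ} (hs : 0 ≤ s) (ha : 0 < a) (b : ℕ) :
    ∫ z : ℂ, ‖z‖ ^ (2 * (s + b)) * Real.exp (-a * ‖z‖ ^ 2) =
      Real.pi * Real.Gamma (s + b + 1) / a ^ (s + b + 1) := by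
  have h := Complex.integral_rpow_mul_exp_neg_mul_rpow (p := 2) (q := 2 * (s + b)) (b := a)
    (by norm_num) (by have := b.cast_nonneg (α := ℝ); linarith) ha
  simp only [Real.rpow_two] at h
  rw [h, show -(2 * (s + b) + 2) / 2 = -(s + b + 1) by ring,
    show (2 * (s + b) + 2) / 2 = s + b + 1 by ring, Real.rpow_neg ha.le]
  ring

theorem setIntegral_annulus_norm_pow {r R : ℝ} (hr : 0 ≤ r) (hrR : r ≤ R) (b : ℕ) :
    ∫ z in {z : ℂ | r < ‖z‖ ∧ ‖z‖ < R}, ‖z‖ ^ (2 * b) =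
      Real.pi * (((R ^ 2) ^ (b + 1) - (r ^ 2) ^ (b + 1)) / ((b : ℝ) + 1)) := by
  have hm : MeasurableSet {z : ℂ | r < ‖z‖ ∧ ‖z‖ < R} :=
    (measurableSet_lt measurable_const measurable_norm).inter
      (measurableSet_lt measurable_norm measurable_const)
  rw [← integral_indicator hm]
  have h := integral_fun_norm_addHaar (volume : Measure ℂ)
    ((Set.Ioo r R).indicator fun y : ℝ => y ^ (2 * b))
  have e : ({z : ℂ | r < ‖z‖ ∧ ‖z‖ < R}.indicator fun z : ℂ => ‖z‖ ^ (2 * b)) =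
      fun z : ℂ => (Set.Ioo r R).indicator (fun y : ℝ => y ^ (2 * b)) ‖z‖ := by
    ext z
    simp [Set.indicator_apply]
  have e' : (fun y : ℝ => y ^ (Module.finrank ℝ ℂ - 1) •
      (Set.Ioo r R).indicator (fun y : ℝ => y ^ (2 * b)) y) =
      (Set.Ioo r R).indicator fun y : ℝ => y ^ (2 * b + 1) := by
    ext y
    simp only [Set.indicator_apply, Complex.finrank_real_complex]
    split_ifs <;> simp [pow_succ']
  rw [e, h, e', setIntegral_indicator measurableSet_Ioo, Set.inter_eq_right.2
    (fun y (hy : y ∈ Set.Ioo r R) => Set.mem_Ioi.2 (hr.trans_lt hy.1)), ← integral_Ioc_eq_integral_Ioo,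
    ← intervalIntegral.integral_of_le hrR, integral_pow]
  have hb : (b : ℝ) + 1 ≠ 0 := by positivity
  simp [Measure.real, Complex.volume_ball]
  rw [show (2 * (b : ℝ) + 1 + 1) = 2 * (b + 1) by ring, show 2 * b + 1 + 1 = 2 * (b + 1) by ring,
    pow_mul, pow_mul]
  field_simp

theorem integral_annulusUniform_norm_pow {c : ℝ} (hc : 1 ≤ c) (b : ℕ) :
    ∫ z : ℂ, ‖z‖ ^ (2 * b) ∂(annulusUniform c) =
      (c ^ (b + 1) - (c - 1) ^ (b + 1)) / ((b : ℝ) + 1) := by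
  have h := fun b => setIntegral_annulus_norm_pow (Real.sqrt_nonneg (c - 1))
    (Real.sqrt_le_sqrt (by linarith : c - 1 ≤ c)) b
  simp only [Real.sq_sqrt (by linarith : 0 ≤ c), Real.sq_sqrt (by linarith : 0 ≤ c - 1)] at h
  have h0 := h 0
  simp only [mul_zero, pow_zero, zero_add, pow_one, sub_sub_cancel, Nat.cast_zero, div_one,
    mul_one, setIntegral_const, smul_eq_mul, Measure.real] at h0
  rw [annulusUniform, integral_smul_measure, h, ENNReal.toReal_inv, h0, smul_eq_mul,
    inv_mul_cancel_left₀ Real.pi_ne_zero]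

theorem integral_withDensity_norm_pow {c : ℝ} (hc : 1 ≤ c) (b : ℕ) {n : ℕ} (hn : 1 ≤ n) :
    ∫ z : ℂ, ‖z‖ ^ (2 * b) ∂(volume.withDensity (fun z : ℂ =>
      ENNReal.ofReal (((n : ℝ) ^ ((c - 1) * (n : ℝ)) / Real.pi) *
        (∑ k ∈ Finset.range n,
          (n : ℝ) ^ k * ‖z‖ ^ (2 * ((k : ℝ) + (c - 1) * (n : ℝ))) /
            Real.Gamma ((k : ℝ) + (c - 1) * (n : ℝ) + 1)) *
        Real.exp (-(n : ℝ) * ‖z‖ ^ 2)))) =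
      (1 / ((b : ℝ) + 1)) *
        (∏ i ∈ Finset.range (b + 1), (c + (i : ℝ) / (n : ℝ)) -
          ∏ i ∈ Finset.range (b + 1), ((c - 1) + (i : ℝ) / (n : ℝ))) := by
  have hn0 : (0 : ℝ) < n := by exact_mod_cast hn
  obtain ⟨t, ht⟩ : ∃ t, t = (c - 1) * (n : ℝ) := ⟨_, rfl⟩
  have ht0 : 0 ≤ t := ht ▸ mul_nonneg (by linarith) hn0.le
  have hG : ∀ k : ℕ, 0 < Real.Gamma (k + t + 1) := fun k => Real.Gamma_pos_of_pos (by positivity)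
  simp only [← ht]
  rw [integral_withDensity_eq_integral_toReal_smul (by fun_prop) (by simp)]
  have e : ∀ z : ℂ, (ENNReal.ofReal ((n : ℝ) ^ t / Real.pi *
      (∑ k ∈ Finset.range n, (n : ℝ) ^ k * ‖z‖ ^ (2 * ((k : ℝ) + t)) / Real.Gamma (k + t + 1)) *
        Real.exp (-(n : ℝ) * ‖z‖ ^ 2))).toReal • ‖z‖ ^ (2 * b) =
      ∑ k ∈ Finset.range n, (n : ℝ) ^ t / Real.pi * (n : ℝ) ^ k / Real.Gamma (k + t + 1) *
        (‖z‖ ^ (2 * ((k + t) + b)) * Real.exp (-(n : ℝ) * ‖z‖ ^ 2)) := by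
    intro z
    rw [ENNReal.toReal_ofReal]
    · rw [smul_eq_mul, Finset.mul_sum, Finset.sum_mul, Finset.sum_mul]
      refine Finset.sum_congr rfl fun k _ => ?_
      have : ‖z‖ ^ (2 * ((k + t) + b)) = ‖z‖ ^ (2 * (k + t)) * ‖z‖ ^ (2 * b) := by
        rw [mul_add 2 ((k : ℝ) + t), Real.rpow_add_of_nonneg (norm_nonneg z) (by positivity)
          (by positivity), ← Real.rpow_natCast ‖z‖ (2 * b)]
        push_cast
        rfl
      rw [this]
      ring
    · have := Finset.sum_nonneg fun k (_ : k ∈ Finset.range n) =>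
        div_nonneg (by positivity : 0 ≤ (n : ℝ) ^ k * ‖z‖ ^ (2 * ((k : ℝ) + t))) (hG k).le
      positivity
  have hI : ∀ k : ℕ, ∫ z : ℂ, ‖z‖ ^ (2 * (((k : ℝ) + t) + b)) * Real.exp (-(n : ℝ) * ‖z‖ ^ 2) =
      Real.pi * Real.Gamma (k + t + b + 1) / (n : ℝ) ^ ((k : ℝ) + t + b + 1) :=
    fun k => integral_norm_rpow_mul_exp (by positivity) hn0 b
  simp only [e]
  rw [integral_finsetSum]
  · have hterm : ∀ k : ℕ, (n : ℝ) ^ t / Real.pi * (n : ℝ) ^ k / Real.Gamma (k + t + 1) *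
        (Real.pi * Real.Gamma (k + t + b + 1) / (n : ℝ) ^ ((k : ℝ) + t + b + 1)) =
        (∏ i ∈ Finset.range b, (k + t + 1 + i)) / (n : ℝ) ^ (b + 1) := by
      intro k
      have : (n : ℝ) ^ ((k : ℝ) + t + b + 1) = n ^ t * n ^ k * n ^ (b + 1) := by
        rw [← Real.rpow_natCast, ← Real.rpow_natCast, ← Real.rpow_add hn0, ← Real.rpow_add hn0]
        congr 1
        push_cast
        ring
      rw [this, Real.Gamma_add_nat_add_one (by positivity)]
      have := (hG k).ne'
      have := (Real.rpow_pos_of_pos hn0 t).ne'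
      field_simp
    have hprod : ∀ x y : ℝ, y = x * n →
        ∏ i ∈ Finset.range (b + 1), (x + (i : ℝ) / n) =
          (∏ i ∈ Finset.range (b + 1), (y + i)) / (n : ℝ) ^ (b + 1) := by
      rintro x y rfl
      rw [eq_div_iff (by positivity), ← Finset.card_range (b + 1), ← Finset.prod_const,
        Finset.card_range, ← Finset.prod_mul_distrib]
      refine Finset.prod_congr rfl fun i _ => ?_
      field_simp
    simp only [integral_const_mul, hI, hterm]
    rw [← Finset.sum_div, hprod c (n + t) (by rw [ht]; ring), hprod (c - 1) t ht, ← sub_div,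
      ← sum_prod_range_add]
    field_simp
  · intro k _
    refine Integrable.const_mul (.of_integral_ne_zero ?_) _
    rw [hI]
    have : 0 < Real.Gamma (k + t + b + 1) := Real.Gamma_pos_of_pos (by positivity)
    positivity

theorem tendsto_prod_add_div_sub (c : ℝ) (b : ℕ) :
    Tendsto (fun n : ℕ => (1 / ((b : ℝ) + 1)) *
        (∏ i ∈ Finset.range (b + 1), (c + (i : ℝ) / (n : ℝ)) -
          ∏ i ∈ Finset.range (b + 1), ((c - 1) + (i : ℝ) / (n : ℝ)))) atTop
      (nhds ((c ^ (b + 1) - (c - 1) ^ (b + 1)) / ((b : ℝ) + 1))) := by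
  have h : ∀ x : ℝ, Tendsto (fun n : ℕ => ∏ i ∈ Finset.range (b + 1), (x + (i : ℝ) / (n : ℝ)))
      atTop (nhds (x ^ (b + 1))) := by
    intro x
    have := tendsto_finsetProd (Finset.range (b + 1)) fun i _ =>
      (tendsto_const_div_atTop_nhds_zero_nat (i : ℝ)).const_add x
    simpa using this
  rw [← one_div_mul_eq_div _ (c ^ (b + 1) - (c - 1) ^ (b + 1))]
  exact ((h c).sub (h (c - 1))).const_mul _

/-- for `c ≥ 1` and the probability measure `μ n` on `ℂ` with density
`D(z) = (n^{(c-1)n}/π) Σ_{k<n} n^k |z|^{2(k+(c-1)n)}/Γ(k+(c-1)n+1) · e^{-n|z|²}`,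
one has `∫ |z|^{2b} dμ n = (1/(b+1))(∏_{i≤b}(c+i/n) - ∏_{i≤b}(c-1+i/n))`, which converges as
`n → ∞` to `(c^{b+1}-(c-1)^{b+1})/(b+1) = ∫ |z|^{2b} dρ` for the uniform distribution `ρ`
on the annulus `√(c-1) < |z| < √c`. -/
theorem stmt_12 (c : ℝ) (hc : 1 ≤ c) (b : ℕ) (μ : ℕ → Measure ℂ)
    (hμ : ∀ n : ℕ, 1 ≤ n → μ n = volume.withDensity (fun z : ℂ =>
      ENNReal.ofReal (((n : ℝ) ^ ((c - 1) * (n : ℝ)) / Real.pi) *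
        (∑ k ∈ Finset.range n,
          (n : ℝ) ^ k * ‖z‖ ^ (2 * ((k : ℝ) + (c - 1) * (n : ℝ))) /
            Real.Gamma ((k : ℝ) + (c - 1) * (n : ℝ) + 1)) *
        Real.exp (-(n : ℝ) * ‖z‖ ^ 2)))) :
    (∀ n : ℕ, 1 ≤ n →
      ∫ z : ℂ, ‖z‖ ^ (2 * b) ∂(μ n) =
        (1 / ((b : ℝ) + 1)) *
          (∏ i ∈ Finset.range (b + 1), (c + (i : ℝ) / (n : ℝ)) -
           ∏ i ∈ Finset.range (b + 1), ((c - 1) + (i : ℝ) / (n : ℝ)))) ∧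
    Tendsto (fun n : ℕ => ∫ z : ℂ, ‖z‖ ^ (2 * b) ∂(μ n)) atTop
      (nhds ((c ^ (b + 1) - (c - 1) ^ (b + 1)) / ((b : ℝ) + 1))) ∧
    (c ^ (b + 1) - (c - 1) ^ (b + 1)) / ((b : ℝ) + 1) =
      ∫ z : ℂ, ‖z‖ ^ (2 * b) ∂(annulusUniform c) := by
  have h : ∀ n : ℕ, 1 ≤ n → ∫ z : ℂ, ‖z‖ ^ (2 * b) ∂(μ n) = _ := fun n hn =>
    (congrArg (fun ν : Measure ℂ => ∫ z : ℂ, ‖z‖ ^ (2 * b) ∂ν) (hμ n hn)).trans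
      (integral_withDensity_norm_pow hc b hn)
  refine ⟨h, (tendsto_prod_add_div_sub c b).congr' ?_, (integral_annulusUniform_norm_pow hc b).symm⟩
  filter_upwards [eventually_ge_atTop 1] with n hn
  exact (h n hn).symm
end

section
/- Let H = ⊕_{k=2}^∞ H_k be the Hilbert space direct sum (ℓ²-sum), where H_k is k-dimensional Hilbert space with orthonormal basis e₁^{(k)},…,e_k^{(k)}, and let T = ⊕_{k=2}^∞ T_k, where T_k is the nilpotent operator on H_k defined by T_k e₁^{(k)} = 0 and T_k e_j^{(k)} = e_{j−1}^{(k)} for 2 ≤ j ≤ k. Then (a) T is a bounded operator on H; (b) for every r > 0, the subspace E_r(T) is dense in H; and (c) for 0 < r < 1, the vector ξ = Σ_{k=2}^∞ (1/k) e_k^{(k)} belongs to H but not to E_r(T); consequently, for 0 < r < 1, E_r(T) is dense but not closed. -/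
open Filter

set_option synthInstance.maxHeartbeats 1000000
set_option maxHeartbeats 1000000

/-- `Er T r` is the set of vectors `ξ` with `limsup_k ‖T^k ξ‖^(1/k) ≤ r`. -/
def Er {H : Type*} [NormedAddCommGroup H] [InnerProductSpace ℂ H]
    (T : H →L[ℂ] H) (r : ℝ) : Set H :=
  {ξ : H | Filter.limsup (fun k : ℕ => ‖(T ^ k) ξ‖ ^ (1 / (k : ℝ))) Filter.atTop ≤ r}

/-- The truncated backward shift on `EuclideanSpace ℂ (Fin n)`: it sends the first basis vector
to `0` and every other one to its predecessor. -/
def truncShift (n : ℕ) : EuclideanSpace ℂ (Fin n) →ₗ[ℂ] EuclideanSpace ℂ (Fin n) where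
  toFun x := WithLp.toLp 2 fun j => if h : (j : ℕ) + 1 < n then x ⟨(j : ℕ) + 1, h⟩ else 0
  map_add' x y := by
    ext j
    by_cases h : (j : ℕ) + 1 < n <;> simp [h]
  map_smul' c x := by
    ext j
    by_cases h : (j : ℕ) + 1 < n <;> simp [h]

lemma truncShift_apply (n : ℕ) (x : EuclideanSpace ℂ (Fin n)) (j : Fin n) :
    truncShift n x j = if h : (j : ℕ) + 1 < n then x ⟨(j : ℕ) + 1, h⟩ else 0 := rfl

lemma norm_truncShift_le (n : ℕ) (x : EuclideanSpace ℂ (Fin n)) : ‖truncShift n x‖ ≤ ‖x‖ := by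
  refine le_of_sq_le_sq ?_ (norm_nonneg x)
  rw [EuclideanSpace.norm_sq_eq, EuclideanSpace.norm_sq_eq]
  cases n with
  | zero => simp
  | succ n =>
    rw [Fin.sum_univ_castSucc, Fin.sum_univ_succ]
    have h : ∀ i : Fin n, truncShift (n + 1) x i.castSucc = x i.succ := fun i => by
      rw [truncShift_apply, dif_pos (by simp)]
      rfl
    have h' : truncShift (n + 1) x (Fin.last n) = 0 := by
      rw [truncShift_apply, dif_neg (by simp)]
    simp only [h, h', norm_zero]
    nlinarith [sq_nonneg ‖x 0‖]

/-- The `ℓ²`-direct sum of the truncated shifts in dimensions `2, 3, 4, …`. -/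
noncomputable def sumShift : (lp (fun k : ℕ => EuclideanSpace ℂ (Fin (k + 2))) 2) →L[ℂ]
    (lp (fun k : ℕ => EuclideanSpace ℂ (Fin (k + 2))) 2) :=
  LinearMap.mkContinuous
    { toFun := fun x => ⟨fun k => truncShift (k + 2) (x k),
        (lp.memℓp x).mono' fun k => norm_truncShift_le _ _⟩
      map_add' := fun x y => by
        ext1
        funext k
        exact map_add (truncShift (k + 2)) (x k) (y k)
      map_smul' := fun c x => by
        ext1
        funext k
        exact map_smul (truncShift (k + 2)) c (x k) }
    1 fun x => by
      rw [one_mul]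
      exact lp.norm_mono (by simp) fun k => norm_truncShift_le _ _

lemma sumShift_apply (x : lp (fun k : ℕ => EuclideanSpace ℂ (Fin (k + 2))) 2) (k : ℕ) :
    sumShift x k = truncShift (k + 2) (x k) := rfl

lemma norm_sumShift_le (x : lp (fun k : ℕ => EuclideanSpace ℂ (Fin (k + 2))) 2) :
    ‖sumShift x‖ ≤ ‖x‖ :=
  lp.norm_mono (by simp) fun _ => norm_truncShift_le _ _

lemma norm_sumShift_pow_le (n : ℕ) (x : lp (fun k : ℕ => EuclideanSpace ℂ (Fin (k + 2))) 2) :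
    ‖(sumShift ^ n) x‖ ≤ ‖x‖ := by
  induction n with
  | zero => simp
  | succ n ih =>
    rw [pow_succ', mul_apply_eq_comp]
    exact (norm_sumShift_le _).trans ih

lemma sumShift_pow_apply (n : ℕ) (x : lp (fun k : ℕ => EuclideanSpace ℂ (Fin (k + 2))) 2)
    (k : ℕ) (j : Fin (k + 2)) :
    (sumShift ^ n) x k j = if h : (j : ℕ) + n < k + 2 then x k ⟨(j : ℕ) + n, h⟩ else 0 := by
  induction n generalizing j with
  | zero => simp
  | succ n ih =>
    rw [pow_succ', mul_apply_eq_comp, sumShift_apply, truncShift_apply]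
    split_ifs with h h' h'
    · rw [ih, dif_pos (by simp only; omega)]
      exact congrArg (fun i => x k i) (Fin.ext (by simp only; omega))
    · rw [ih, dif_neg (by simp only; omega)]
    · omega
    · rfl

lemma mem_Er_of_pow_apply_eq_zero {H : Type*} [NormedAddCommGroup H] [InnerProductSpace ℂ H]
    {T : H →L[ℂ] H} {r : ℝ} (hr : 0 ≤ r) {ξ : H} (h : ∀ᶠ n in atTop, (T ^ n) ξ = 0) :
    ξ ∈ Er T r := by
  have h0 : (fun k : ℕ => ‖(T ^ k) ξ‖ ^ (1 / (k : ℝ))) =ᶠ[atTop] fun _ => (0 : ℝ) := by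
    filter_upwards [h, eventually_gt_atTop 0] with n hn hpos
    rw [hn, norm_zero, Real.zero_rpow (by positivity)]
  change limsup _ _ ≤ r
  rw [limsup_congr h0, limsup_const]
  exact hr

lemma sumShift_pow_single (k : ℕ) (v : EuclideanSpace ℂ (Fin (k + 2))) {n : ℕ}
    (hn : k + 2 ≤ n) :
    (sumShift ^ n) (lp.single 2 k v : lp (fun k : ℕ => EuclideanSpace ℂ (Fin (k + 2))) 2) = 0 := by
  ext1
  funext i
  ext j
  rw [sumShift_pow_apply]
  split_ifs with h
  · rw [lp.single_apply_ne _ _ _ (by omega)]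
    rfl
  · rfl

lemma dense_Er_sumShift {r : ℝ} (hr : 0 ≤ r) : Dense (Er sumShift r) := by
  intro x
  refine mem_closure_of_tendsto (lp.hasSum_single (by simp) x)
    (Eventually.of_forall fun s => mem_Er_of_pow_apply_eq_zero hr ?_)
  filter_upwards [eventually_ge_atTop (s.sup id + 2)] with n hn
  rw [map_sum]
  refine Finset.sum_eq_zero fun k hk => sumShift_pow_single k _ ?_
  have : k ≤ s.sup id := Finset.le_sup (f := id) hk
  omega

lemma norm_rpow_one_div_isBoundedUnder
    (x : lp (fun k : ℕ => EuclideanSpace ℂ (Fin (k + 2))) 2) :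
    IsBoundedUnder (· ≤ ·) atTop fun n : ℕ => ‖(sumShift ^ n) x‖ ^ (1 / (n : ℝ)) := by
  refine isBoundedUnder_of ⟨max 1 ‖x‖, fun n => ?_⟩
  calc ‖(sumShift ^ n) x‖ ^ (1 / (n : ℝ))
      ≤ (max 1 ‖x‖) ^ (1 / (n : ℝ)) := by
        gcongr
        exact (norm_sumShift_pow_le n x).trans (le_max_right _ _)
    _ ≤ (max 1 ‖x‖) ^ (1 : ℝ) := by
        refine Real.rpow_le_rpow_of_exponent_le (le_max_left _ _) ?_
        rw [one_div]
        exact Nat.cast_inv_le_one n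
    _ = max 1 ‖x‖ := Real.rpow_one _

/-- The vector whose component in dimension `d` is `1 / d` times the last basis vector. -/
noncomputable def lastVector : lp (fun k : ℕ => EuclideanSpace ℂ (Fin (k + 2))) 2 :=
  ⟨fun k => EuclideanSpace.single (Fin.last (k + 1)) (1 / (k + 2) : ℂ), by
    apply memℓp_gen
    have h := (summable_nat_add_iff 2).2 (Real.summable_one_div_nat_pow.2 one_lt_two)
    refine h.congr fun k => ?_
    have hk : ‖(k + 2 : ℂ)‖ = k + 2 := by
      exact_mod_cast Complex.norm_natCast (k + 2)
    simp [hk]⟩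

lemma lastVector_apply (k : ℕ) (j : Fin (k + 2)) :
    lastVector k j = if (j : ℕ) = k + 1 then (1 / (k + 2) : ℂ) else 0 := by
  change EuclideanSpace.single (Fin.last (k + 1)) (1 / (k + 2) : ℂ) j = _
  simp [Fin.ext_iff]

lemma one_div_le_norm_sumShift_pow_lastVector (n : ℕ) :
    1 / (n + 2 : ℝ) ≤ ‖(sumShift ^ n) lastVector‖ := by
  refine le_trans ?_ (lp.norm_apply_le_norm (by simp) _ n)
  refine le_trans ?_ (PiLp.norm_apply_le _ (1 : Fin (n + 2)))
  have hk : ‖(n + 2 : ℂ)‖ = n + 2 := by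
    exact_mod_cast Complex.norm_natCast (n + 2)
  rw [sumShift_pow_apply, dif_pos (by simp; omega), lastVector_apply, if_pos (by simp; omega)]
  simp [hk]

lemma tendsto_one_div_add_two_rpow :
    Tendsto (fun n : ℕ => (1 / (n + 2 : ℝ)) ^ (1 / (n : ℝ))) atTop (nhds 1) := by
  have h := (tendsto_rpow_div_mul_add (-1) 1 (-2) zero_ne_one).comp
    (tendsto_natCast_atTop_atTop.atTop_add (tendsto_const_nhds (x := (2 : ℝ))) :
      Tendsto (fun n : ℕ => (n + 2 : ℝ)) atTop atTop)
  refine h.congr fun n => ?_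
  have hn : (0 : ℝ) ≤ n + 2 := by positivity
  simp only [Function.comp_apply]
  rw [one_div (n + 2 : ℝ), Real.inv_rpow hn, ← Real.rpow_neg hn]
  ring_nf

lemma lastVector_notMem_Er {r : ℝ} (hr : r < 1) : lastVector ∉ Er sumShift r := by
  intro h
  obtain ⟨s, hrs, hs⟩ := exists_between hr
  have hlt := eventually_lt_of_limsup_lt (lt_of_le_of_lt h hrs)
    (norm_rpow_one_div_isBoundedUnder lastVector)
  obtain ⟨n, h1, h2⟩ := (hlt.and (tendsto_one_div_add_two_rpow.eventually_const_lt hs)).exists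
  have h3 : (1 / (n + 2 : ℝ)) ^ (1 / (n : ℝ)) ≤ ‖(sumShift ^ n) lastVector‖ ^ (1 / (n : ℝ)) := by
    gcongr
    exact one_div_le_norm_sumShift_pow_lastVector n
  linarith

/-- on the ℓ²-direct sum `H = ⊕_{k} H_k` of finite dimensional Hilbert spaces
(`H_k` of dimension `k + 2`, i.e. dimensions `2, 3, 4, …`), the direct sum `T` of the
truncated shifts (`T e₁ = 0`, `T e_j = e_{j-1}`) is a bounded operator, for every `r > 0` the
set `E_r(T)` is dense, and for `0 < r < 1` the vector `ξ = Σ_k (1/dim H_k) e_{dim H_k}^{(k)}`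
lies in `H` but not in `E_r(T)`; consequently `E_r(T)` is dense but not closed. -/
theorem stmt_17 :
    ∃ T : (lp (fun k : ℕ => EuclideanSpace ℂ (Fin (k + 2))) 2) →L[ℂ]
        (lp (fun k : ℕ => EuclideanSpace ℂ (Fin (k + 2))) 2),
      (∀ x : lp (fun k : ℕ => EuclideanSpace ℂ (Fin (k + 2))) 2,
        ∀ (k : ℕ) (j : Fin (k + 2)),
          T x k j = if h : (j : ℕ) + 1 < k + 2 then x k ⟨(j : ℕ) + 1, h⟩ else 0) ∧
      (∀ r : ℝ, 0 < r → Dense (Er T r)) ∧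
      (∀ r : ℝ, 0 < r → r < 1 →
        (∃ ξ : lp (fun k : ℕ => EuclideanSpace ℂ (Fin (k + 2))) 2,
          (∀ (k : ℕ) (j : Fin (k + 2)),
            ξ k j = if (j : ℕ) = k + 1 then (1 / (k + 2) : ℂ) else 0) ∧
          ξ ∉ Er T r) ∧
        ¬ IsClosed (Er T r)) := by
  refine ⟨sumShift, fun x k j => rfl, fun r hr => dense_Er_sumShift hr.le, fun r hr0 hr1 =>
    ⟨⟨lastVector, lastVector_apply, lastVector_notMem_Er hr1⟩, fun hc => ?_⟩⟩
  have h := hc.closure_eq ▸ dense_Er_sumShift hr0.le lastVector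
  exact lastVector_notMem_Er hr1 h
end
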